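/- arXiv:1812.10034 — 5 statements merged into one kernel-verified Lean document; each statement's English description precedes it below -/
import Mathlib

section
/- Let G = K_{n_1,n_2,…,n_k} be the complete k-partite graph of order n = n_1 + n_2 + … + n_k, where k ≥ 2, 1 ≤ n_1 ≤ n_2 ≤ … ≤ n_k and n_k ≥ 2. Then rvd(G) = n if k ≥ 4, or if k = 3 and n_1 ≥ 2; rvd(G) = n − n_{k−1} if k = 3 and n_1 = 1, or if k = 2 and n_1 ≥ 2; and rvd(G) = 1 if k = 2 and n_1 = 1. -/
open SimpleGraph

/-- A set of vertices is rainbow under a coloring `c` if no two of its vertices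
receive the same color. -/
def RainbowSet {V : Type*} (c : V → ℕ) (S : Set V) : Prop := Set.InjOn c S

/-- `c` is a rainbow vertex-disconnection coloring of `G`: for every two distinct
vertices `x, y` there is a set `S` avoiding `x` and `y` such that every `x`-`y` walk
in `G - xy` (which is `G` itself when `x, y` are nonadjacent) meets `S` (i.e. `S` is
an `x`-`y` vertex-cut), and moreover `S` is rainbow when `x, y` are nonadjacent,
while `S ∪ {x}` or `S ∪ {y}` is rainbow when `x, y` are adjacent. -/
def IsRVDColoring {V : Type*} (G : SimpleGraph V) (c : V → ℕ) : Prop :=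
  ∀ x y : V, x ≠ y → ∃ S : Set V, x ∉ S ∧ y ∉ S ∧
    (∀ p : (G.deleteEdges {s(x, y)}).Walk x y, ∃ v ∈ p.support, v ∈ S) ∧
    (¬ G.Adj x y → RainbowSet c S) ∧
    (G.Adj x y → (RainbowSet c (insert x S) ∨ RainbowSet c (insert y S)))

/-- The rainbow vertex-disconnection number `rvd G`: the minimum number of colors
used by a rainbow vertex-disconnection coloring of `G`. -/
noncomputable def rvd {V : Type*} (G : SimpleGraph V) : ℕ :=
  sInf {k | ∃ c : V → ℕ, IsRVDColoring G c ∧ (Set.range c).ncard = k}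

/-- A walk joining two distinct vertices after deletion of the edge between them meets the set of
the remaining neighbors of its starting vertex. -/
theorem exists_mem_support_neighborSet_diff {V : Type*} (G : SimpleGraph V) {x y : V}
    (hxy : x ≠ y) (p : (G.deleteEdges {s(x, y)}).Walk x y) :
    ∃ v ∈ p.support, v ∈ G.neighborSet x \ {y} := by
  cases p with
  | nil => exact absurd rfl hxy
  | @cons _ w _ h q =>
    rw [deleteEdges_adj] at h
    refine ⟨w, by simp, h.1, fun hw => h.2 ?_⟩
    rw [Set.mem_singleton_iff] at hw ⊢
    rw [hw]

theorem exists_mem_support_neighborSet_diff' {V : Type*} (G : SimpleGraph V) {x y : V}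
    (hxy : x ≠ y) (p : (G.deleteEdges {s(x, y)}).Walk x y) :
    ∃ v ∈ p.support, v ∈ G.neighborSet y \ {x} := by
  have e : G.deleteEdges {s(x, y)} = G.deleteEdges {s(y, x)} := by rw [Sym2.eq_swap]
  obtain ⟨v, hv, h⟩ :=
    exists_mem_support_neighborSet_diff G hxy.symm (p.reverse.mapLe e.le)
  exact ⟨v, by simpa using hv, h⟩

/-- A coloring is a rainbow vertex-disconnection coloring as soon as, among any two vertices, one
has a rainbow neighborhood. -/
theorem isRVDColoring_of_rainbowSet_neighborSet {V : Type*} (G : SimpleGraph V) (c : V → ℕ)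
    (h : ∀ x y, x ≠ y → RainbowSet c (G.neighborSet x) ∨ RainbowSet c (G.neighborSet y)) :
    IsRVDColoring G c := by
  intro x y hxy
  rcases h x y hxy with h | h
  · refine ⟨G.neighborSet x \ {y}, by simp, by simp,
      exists_mem_support_neighborSet_diff G hxy, fun _ => h.mono Set.sdiff_subset,
      fun ha => Or.inr (h.mono ?_)⟩
    exact Set.insert_subset ha Set.sdiff_subset
  · refine ⟨G.neighborSet y \ {x}, by simp, by simp,
      exists_mem_support_neighborSet_diff' G hxy, fun _ => h.mono Set.sdiff_subset,
      fun ha => Or.inl (h.mono ?_)⟩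
    exact Set.insert_subset ha.symm Set.sdiff_subset

/-- A set meeting every `x`-`y` walk avoiding the edge `xy` contains all common neighbors. -/
theorem commonNeighbors_subset_of_forall_walk {V : Type*} (G : SimpleGraph V) {x y : V}
    {S : Set V} (hx : x ∉ S) (hy : y ∉ S)
    (hS : ∀ p : (G.deleteEdges {s(x, y)}).Walk x y, ∃ v ∈ p.support, v ∈ S) :
    G.commonNeighbors x y ⊆ S := by
  intro u hu
  obtain ⟨h₁, h₂⟩ := G.mem_commonNeighbors.1 hu
  have a₁ : (G.deleteEdges {s(x, y)}).Adj x u := by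
    rw [deleteEdges_adj]
    refine ⟨h₁, ?_⟩
    have := h₁.ne
    have := h₂.ne
    simp only [Set.mem_singleton_iff, Sym2.eq_iff]
    grind
  have a₂ : (G.deleteEdges {s(x, y)}).Adj u y := by
    rw [deleteEdges_adj]
    refine ⟨h₂.symm, ?_⟩
    have := h₁.ne
    have := h₂.ne
    simp only [Set.mem_singleton_iff, Sym2.eq_iff]
    grind
  obtain ⟨v, hv, hvS⟩ := hS (.cons a₁ (.cons a₂ .nil))
  simp only [Walk.support_cons, Walk.support_nil, List.mem_cons, List.not_mem_nil,
    or_false] at hv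
  rcases hv with rfl | rfl | rfl
  · exact absurd hvS hx
  · exact hvS
  · exact absurd hvS hy

theorem IsRVDColoring.rainbowSet_commonNeighbors {V : Type*} {G : SimpleGraph V} {c : V → ℕ}
    (h : IsRVDColoring G c) {x y : V} (hxy : x ≠ y) : RainbowSet c (G.commonNeighbors x y) := by
  obtain ⟨S, hx, hy, hS, h₁, h₂⟩ := h x y hxy
  have hsub := commonNeighbors_subset_of_forall_walk G hx hy hS
  by_cases ha : G.Adj x y
  · rcases h₂ ha with h | h <;> exact h.mono (hsub.trans (Set.subset_insert _ _))
  · exact (h₁ ha).mono hsub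

theorem IsRVDColoring.rainbowSet_insert_commonNeighbors {V : Type*} {G : SimpleGraph V}
    {c : V → ℕ} (h : IsRVDColoring G c) {x y : V} (ha : G.Adj x y) :
    RainbowSet c (insert x (G.commonNeighbors x y)) ∨
      RainbowSet c (insert y (G.commonNeighbors x y)) := by
  obtain ⟨S, hx, hy, hS, -, h₂⟩ := h x y ha.ne
  have hsub := commonNeighbors_subset_of_forall_walk G hx hy hS
  exact (h₂ ha).imp (fun h => h.mono (Set.insert_subset_insert hsub))
    (fun h => h.mono (Set.insert_subset_insert hsub))

theorem RainbowSet.card_le_ncard_range {V : Type*} [Finite V] {c : V → ℕ} {T : Finset V}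
    (h : RainbowSet c (T : Set V)) : T.card ≤ (Set.range c).ncard := by
  rw [← Set.ncard_coe_finset, ← Set.InjOn.ncard_image h]
  exact Set.ncard_le_ncard (Set.image_subset_range _ _) (Set.finite_range c)

theorem rvd_eq_of_isRVDColoring {V : Type*} {G : SimpleGraph V} {m : ℕ} {c : V → ℕ}
    (hc : IsRVDColoring G c) (hm : (Set.range c).ncard ≤ m)
    (hlow : ∀ c : V → ℕ, IsRVDColoring G c → m ≤ (Set.range c).ncard) : rvd G = m := by
  refine le_antisymm ((Nat.sInf_le ?_).trans hm) (le_csInf ?_ ?_)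
  · exact ⟨c, hc, rfl⟩
  · exact ⟨_, c, hc, rfl⟩
  rintro _ ⟨d, hd, rfl⟩
  exact hlow d hd

theorem ncard_range_le_of_forall_lt {V : Type*} {c : V → ℕ} {m : ℕ} (h : ∀ v, c v < m) :
    (Set.range c).ncard ≤ m := by
  have hsub : Set.range c ⊆ (Finset.range m : Set ℕ) := by
    rintro _ ⟨v, rfl⟩
    simpa using h v
  simpa using Set.ncard_le_ncard hsub (Finset.finite_toSet _)

/-- If all colors are forced to be distinct, the rainbow vertex-disconnection number is the
order. -/
theorem rvd_eq_card {V : Type*} [Fintype V] {G : SimpleGraph V}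
    (h : ∀ u v, u ≠ v → ∃ x y, x ≠ y ∧ u ∈ G.commonNeighbors x y ∧ v ∈ G.commonNeighbors x y) :
    rvd G = Fintype.card V := by
  let e := Fintype.equivFin V
  have hinj : Function.Injective (fun v => (e v : ℕ)) := Fin.val_injective.comp e.injective
  refine rvd_eq_of_isRVDColoring (c := fun v => (e v : ℕ))
    (isRVDColoring_of_rainbowSet_neighborSet _ _ fun _ _ _ => Or.inl hinj.injOn)
    (ncard_range_le_of_forall_lt fun v => (e v).isLt) fun c hc => ?_
  refine RainbowSet.card_le_ncard_range (T := Finset.univ) fun u _ v _ huv => ?_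
  by_contra hne
  obtain ⟨x, y, hxy, hu, hv⟩ := h u v hne
  exact hne (hc.rainbowSet_commonNeighbors hxy hu hv huv)

theorem mem_commonNeighbors_completeMultipartiteGraph {ι : Type*} {V : ι → Type*}
    {x y v : Σ i, V i} : v ∈ (completeMultipartiteGraph V).commonNeighbors x y ↔
      x.1 ≠ v.1 ∧ y.1 ≠ v.1 := Iff.rfl

theorem rvd_completeMultipartiteGraph_of_four_le {k : ℕ} (hk : 4 ≤ k) (n : Fin k → ℕ)
    (hpos : ∀ i, 1 ≤ n i) :
    rvd (completeMultipartiteGraph (fun i : Fin k => Fin (n i))) = ∑ i, n i := by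
  rw [rvd_eq_card]
  · simp
  intro u v _
  have hcard : 1 < (Finset.univ \ {u.1, v.1} : Finset (Fin k)).card := by
    have h₁ := Finset.le_card_sdiff ({u.1, v.1} : Finset (Fin k)) Finset.univ
    have h₂ := Finset.card_le_two (a := u.1) (b := v.1)
    rw [Finset.card_univ, Fintype.card_fin] at h₁
    omega
  obtain ⟨i, hi, j, hj, hij⟩ := Finset.one_lt_card.1 hcard
  simp only [Finset.mem_sdiff, Finset.mem_univ, true_and, Finset.mem_insert,
    Finset.mem_singleton, not_or] at hi hj
  exact ⟨⟨i, 0, hpos i⟩, ⟨j, 0, hpos j⟩, fun h => hij (congrArg Sigma.fst h),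
    ⟨hi.1, hj.1⟩, ⟨hi.2, hj.2⟩⟩

theorem rvd_completeMultipartiteGraph_fin_three (n : Fin 3 → ℕ) (hn : ∀ i, 2 ≤ n i) :
    rvd (completeMultipartiteGraph (fun i : Fin 3 => Fin (n i))) = ∑ i, n i := by
  rw [rvd_eq_card]
  · simp
  intro u v _
  by_cases huv : u.1 = v.1
  · have : ∀ a : Fin 3, ∃ i j, i ≠ j ∧ i ≠ a ∧ j ≠ a := by decide
    obtain ⟨i, j, hij, hi, hj⟩ := this u.1
    exact ⟨⟨i, 0, by grind⟩, ⟨j, 0, by grind⟩, fun h => hij (congrArg Sigma.fst h),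
      ⟨hi, hj⟩, ⟨huv ▸ hi, huv ▸ hj⟩⟩
  · have : ∀ a b : Fin 3, ∃ i, i ≠ a ∧ i ≠ b := by decide
    obtain ⟨i, hu, hv⟩ := this u.1 v.1
    exact ⟨⟨i, 0, by grind⟩, ⟨i, 1, hn i⟩, by simp, ⟨hu, hu⟩, ⟨hv, hv⟩⟩

theorem rvd_completeMultipartiteGraph_fin_three_of_one (n : Fin 3 → ℕ) (h₀ : n 0 = 1)
    (h₁ : 1 ≤ n 1) (h₁₂ : n 1 ≤ n 2) :
    rvd (completeMultipartiteGraph (fun i : Fin 3 => Fin (n i))) = n 2 + 1 := by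
  have hle : ∀ i, i ≠ 0 → n i ≤ n 2 := by
    intro i hi
    fin_cases i
    · exact absurd rfl hi
    · exact h₁₂
    · exact le_rfl
  have huniq : ∀ x y : (Σ i : Fin 3, Fin (n i)), x.1 = 0 → y.1 = 0 → x = y := by
    rintro ⟨i, a, ha⟩ ⟨j, b, hb⟩ hi hj
    dsimp only at hi hj
    subst hi hj
    obtain rfl : a = b := by omega
    rfl
  let c : (Σ i : Fin 3, Fin (n i)) → ℕ := fun p => if p.1 = 0 then n 2 else p.2
  have hrb : ∀ x : (Σ i : Fin 3, Fin (n i)), x.1 ≠ 0 →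
      RainbowSet c ((completeMultipartiteGraph (fun i : Fin 3 => Fin (n i))).neighborSet x) := by
    rintro x hx ⟨i, a⟩ hu ⟨j, b⟩ hv huv
    replace hu : x.1 ≠ i := hu
    replace hv : x.1 ≠ j := hv
    by_cases hi : i = 0 <;> by_cases hj : j = 0
    · exact huniq _ _ hi hj
    · simp only [c, hi, hj, if_true, if_false] at huv
      have := hle j hj
      omega
    · simp only [c, hi, hj, if_true, if_false] at huv
      have := hle i hi
      omega
    · simp only [c, hi, hj, if_false] at huv
      obtain rfl : i = j := by omega
      rw [Fin.ext huv]
  refine rvd_eq_of_isRVDColoring (c := c) (isRVDColoring_of_rainbowSet_neighborSet _ _ ?_)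
    (ncard_range_le_of_forall_lt ?_) fun d hd => ?_
  · intro x y hxy
    by_cases hx : x.1 = 0
    · exact Or.inr (hrb y fun hy => hxy (huniq x y hx hy))
    · exact Or.inl (hrb x hx)
  · rintro ⟨i, a⟩
    by_cases hi : i = 0
    · simp [c, hi]
    · have := hle i hi
      simp only [c, hi, if_false]
      omega
  · let x : (Σ i : Fin 3, Fin (n i)) := ⟨0, 0, by omega⟩
    let y : (Σ i : Fin 3, Fin (n i)) := ⟨1, 0, by omega⟩
    have hxy : (completeMultipartiteGraph (fun i : Fin 3 => Fin (n i))).Adj x y :=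
      show (0 : Fin 3) ≠ 1 by decide
    let P : Finset (Σ i : Fin 3, Fin (n i)) := Finset.univ.map (Function.Embedding.sigmaMk 2)
    have hP : (P : Set _) ⊆
        (completeMultipartiteGraph (fun i : Fin 3 => Fin (n i))).commonNeighbors x y := by
      intro v hv
      obtain ⟨a, -, rfl⟩ := Finset.mem_map.1 (Finset.mem_coe.1 hv)
      exact ⟨show (0 : Fin 3) ≠ 2 by decide, show (1 : Fin 3) ≠ 2 by decide⟩
    have hcard : ∀ z : (Σ i : Fin 3, Fin (n i)), z.1 ≠ 2 → (insert z P).card = n 2 + 1 := by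
      intro z hz
      rw [Finset.card_insert_of_notMem]
      · simp [P]
      · intro hzP
        obtain ⟨a, -, rfl⟩ := Finset.mem_map.1 hzP
        exact hz rfl
    rcases hd.rainbowSet_insert_commonNeighbors hxy with h | h
    · rw [← hcard x (show (0 : Fin 3) ≠ 2 by decide)]
      apply RainbowSet.card_le_ncard_range
      rw [Finset.coe_insert]
      exact h.mono (Set.insert_subset_insert hP)
    · rw [← hcard y (show (1 : Fin 3) ≠ 2 by decide)]
      apply RainbowSet.card_le_ncard_range
      rw [Finset.coe_insert]
      exact h.mono (Set.insert_subset_insert hP)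

theorem rvd_completeMultipartiteGraph_fin_two (n : Fin 2 → ℕ) (h₀ : 2 ≤ n 0)
    (h₀₁ : n 0 ≤ n 1) :
    rvd (completeMultipartiteGraph (fun i : Fin 2 => Fin (n i))) = n 1 := by
  have hle : ∀ i, n i ≤ n 1 := by
    intro i
    fin_cases i
    · exact h₀₁
    · exact le_rfl
  refine rvd_eq_of_isRVDColoring (c := fun p => p.2)
    (isRVDColoring_of_rainbowSet_neighborSet _ _ fun x _ _ => Or.inl ?_)
    (ncard_range_le_of_forall_lt fun p => p.2.isLt.trans_le (hle _)) fun d hd => ?_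
  · rintro ⟨i, a⟩ hu ⟨j, b⟩ hv huv
    replace hu : x.1 ≠ i := hu
    replace hv : x.1 ≠ j := hv
    obtain rfl : i = j := by omega
    exact congrArg (Sigma.mk i) (Fin.ext huv)
  · have hxy : (⟨0, 0, by omega⟩ : Σ i : Fin 2, Fin (n i)) ≠ ⟨0, 1, by omega⟩ := by simp
    have h := hd.rainbowSet_commonNeighbors hxy
    have hcard := RainbowSet.card_le_ncard_range (c := d)
      (T := Finset.univ.map (Function.Embedding.sigmaMk 1)) (h.mono ?_)
    · simpa using hcard
    · intro v hv
      obtain ⟨a, -, rfl⟩ := Finset.mem_map.1 (Finset.mem_coe.1 hv)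
      exact ⟨show (0 : Fin 2) ≠ 1 by decide, show (0 : Fin 2) ≠ 1 by decide⟩

theorem rvd_completeMultipartiteGraph_fin_two_of_one (n : Fin 2 → ℕ) (h₀ : n 0 = 1) :
    rvd (completeMultipartiteGraph (fun i : Fin 2 => Fin (n i))) = 1 := by
  have huniq : ∀ x y : (Σ i : Fin 2, Fin (n i)), x.1 = 0 → y.1 = 0 → x = y := by
    rintro ⟨i, a, ha⟩ ⟨j, b, hb⟩ hi hj
    dsimp only at hi hj
    subst hi hj
    obtain rfl : a = b := by omega
    rfl
  have hrb : ∀ x : (Σ i : Fin 2, Fin (n i)), x.1 ≠ 0 → RainbowSet (fun _ => 0)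
      ((completeMultipartiteGraph (fun i : Fin 2 => Fin (n i))).neighborSet x) := by
    intro x hx u hu v hv _
    replace hu : x.1 ≠ u.1 := hu
    replace hv : x.1 ≠ v.1 := hv
    exact huniq u v (by omega) (by omega)
  refine rvd_eq_of_isRVDColoring (c := fun _ => 0)
    (isRVDColoring_of_rainbowSet_neighborSet _ _ fun x y hxy => ?_)
    (ncard_range_le_of_forall_lt fun _ => Nat.zero_lt_one) fun d _ => ?_
  · by_cases hx : x.1 = 0
    · exact Or.inr (hrb y fun hy => hxy (huniq x y hx hy))
    · exact Or.inl (hrb x hx)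
  · exact (Set.ncard_pos (Set.finite_range d)).2 ⟨_, ⟨0, 0, by omega⟩, rfl⟩

/-- The rainbow vertex-disconnection number of the complete `k`-partite graph
`K_{n₁, …, n_k}` of order `n = n₁ + ⋯ + n_k`, where `k ≥ 2`,
`1 ≤ n₁ ≤ n₂ ≤ ⋯ ≤ n_k` and `n_k ≥ 2`. -/
theorem stmt13 (k : ℕ) (hk : 2 ≤ k) (n : Fin k → ℕ) (hmono : Monotone n)
    (hpos : ∀ i, 1 ≤ n i) (hlast : 2 ≤ n ⟨k - 1, by omega⟩) :
    ((4 ≤ k ∨ (k = 3 ∧ 2 ≤ n ⟨0, by omega⟩)) →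
      rvd (SimpleGraph.completeMultipartiteGraph (fun i : Fin k => Fin (n i))) =
        ∑ i, n i) ∧
    (((k = 3 ∧ n ⟨0, by omega⟩ = 1) ∨ (k = 2 ∧ 2 ≤ n ⟨0, by omega⟩)) →
      rvd (SimpleGraph.completeMultipartiteGraph (fun i : Fin k => Fin (n i))) =
        (∑ i, n i) - n ⟨k - 2, by omega⟩) ∧
    ((k = 2 ∧ n ⟨0, by omega⟩ = 1) →
      rvd (SimpleGraph.completeMultipartiteGraph (fun i : Fin k => Fin (n i))) = 1) := by
  refine ⟨?_, ?_, ?_⟩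
  · rintro (h | ⟨rfl, h⟩)
    · exact rvd_completeMultipartiteGraph_of_four_le h n hpos
    · exact rvd_completeMultipartiteGraph_fin_three n fun i => h.trans (hmono (Fin.zero_le i))
  · rintro (⟨rfl, h⟩ | ⟨rfl, h⟩)
    · have h₀ : n 0 = 1 := h
      refine (rvd_completeMultipartiteGraph_fin_three_of_one n h₀ (hpos 1)
        (hmono (by decide))).trans ?_
      change _ = _ - n 1
      rw [Fin.sum_univ_three]
      omega
    · refine (rvd_completeMultipartiteGraph_fin_two n h (hmono (by decide))).trans ?_
      change _ = _ - n 0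
      rw [Fin.sum_univ_two]
      omega
  · rintro ⟨rfl, h⟩
    exact rvd_completeMultipartiteGraph_fin_two_of_one n h
end

section
/- Let G be a finite simple connected graph with minimum degree δ(G) ≥ 3. Then there exists a cycle C in G such that the graph G − V(C), obtained by deleting the vertex set of C, is connected. -/
namespace SimpleGraph

variable {V : Type*} {G : SimpleGraph V}

/-- In a finite acyclic graph, let every vertex of `D` have two neighbours in `D ∪ A`. Then from any
`y ∈ D` one can walk inside `D` to an edge leading into `A`, different from a prescribed edge at
`y` leaving `D`. -/
lemma IsAcyclic.exists_walk_adj [Finite V] (hG : G.IsAcyclic) {D A : Set V}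
    (hD : ∀ d ∈ D, ∀ z, ∃ w ≠ z, G.Adj d w ∧ (w ∈ D ∨ w ∈ A)) {y z : V} (hy : y ∈ D)
    (hz : z ∉ D) :
    ∃ (x : V) (p : G.Walk y x), (∀ w ∈ p.support, w ∈ D) ∧
      ∃ z' ∈ A, G.Adj x z' ∧ s(y, z) ≠ s(x, z') := by
  by_contra! hcon
  have key : ∀ n : ℕ, ∃ (x : V) (p : G.Walk y x), p.IsPath ∧ (∀ w ∈ p.support, w ∈ D) ∧
      p.length = n := by
    intro n
    induction n with
    | zero => exact ⟨y, .nil, by simp, by simpa using hy, rfl⟩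
    | succ n ih =>
      obtain ⟨x, p, hp, hpD, hn⟩ := ih
      have hx : x ∈ D := hpD x p.end_mem_support
      obtain ⟨w, hadj, hwD, hwp⟩ : ∃ w, G.Adj x w ∧ w ∈ D ∧ w ∉ p.support := by
        by_cases hnil : p.Nil
        · obtain rfl := hnil.eq
          obtain ⟨w, hwz, hadj, hw⟩ := hD y hx z
          refine ⟨w, hadj, ?_, ?_⟩
          · by_contra hwD
            have := hcon y p hpD w (hw.resolve_left hwD) hadj
            simp only [Sym2.eq_iff] at this
            grind
          · rw [Walk.nil_iff_support_eq.1 hnil]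
            simpa using hadj.ne'
        · obtain ⟨w, hwz, hadj, hw⟩ := hD x hx p.penultimate
          have hyx : y ≠ x := by
            rintro rfl
            exact hnil (Walk.isPath_iff_nil.1 hp)
          refine ⟨w, hadj, ?_, fun h ↦ hwz (hG.eq_penultimate_of_adj_end hp hadj h)⟩
          by_contra hwD
          have := hcon x p hpD w (hw.resolve_left hwD) hadj
          simp only [Sym2.eq_iff] at this
          grind
      refine ⟨w, p.concat hadj, hp.concat hwp hadj, ?_, by simp [hn]⟩
      simp only [Walk.support_concat, List.mem_append, List.mem_singleton]
      grind
  have := Fintype.ofFinite V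
  obtain ⟨x, p, hp, -, hn⟩ := key (Fintype.card V)
  exact hp.length_lt.ne hn

/-- A finite graph has a cycle if it has a connected set `A` and a nonempty set `D`, disjoint from
`A`, each of whose vertices has two neighbours in `D ∪ A`. -/
lemma not_isAcyclic_of_two_neighbors [Finite V] {D A : Set V}
    (hD : ∀ d ∈ D, ∀ z, ∃ w ≠ z, G.Adj d w ∧ (w ∈ D ∨ w ∈ A)) (hDne : D.Nonempty)
    (hDA : Disjoint D A) {b : V} (hb : b ∉ D)
    (hA : ∀ u ∈ A, ∀ v ∈ A, ∃ p : G.Walk u v, ∀ w ∈ p.support, w ∈ A) :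
    ¬ G.IsAcyclic := by
  intro hG
  rw [Set.disjoint_left] at hDA
  obtain ⟨d, hd⟩ := hDne
  obtain ⟨y, p, hp, z, hz, hyz, -⟩ := hG.exists_walk_adj hD hd hb
  have hy := hp y p.end_mem_support
  have hzD : z ∉ D := fun h ↦ hDA h hz
  obtain ⟨x, q, hq, z', hz', hxz', hne⟩ := hG.exists_walk_adj hD hy hzD
  obtain ⟨r, hr⟩ := hA z' hz' z hz
  have hmem := isBridge_iff_forall_walk_mem_edges.1
    (isAcyclic_iff_forall_adj_isBridge.1 hG hyz) (q.append (.cons hxz' r))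
  simp only [Walk.edges_append, Walk.edges_cons, List.mem_append, List.mem_cons] at hmem
  rcases hmem with h | h | h
  · exact hzD (hq _ (q.snd_mem_support_of_mem_edges h))
  · exact hne h
  · exact hDA hy (hr _ (r.fst_mem_support_of_mem_edges h))

lemma exists_isCycle_of_not_isAcyclic_induce {S : Set V}
    (h : ¬ ((⊤ : G.Subgraph).induce S).spanningCoe.IsAcyclic) :
    ∃ (v : V) (C : G.Walk v v), C.IsCycle ∧ ∀ w ∈ C.support, w ∈ S := by
  simp only [IsAcyclic, not_forall, not_not] at h
  obtain ⟨v, C, hC⟩ := h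
  refine ⟨v, C.mapLe (Subgraph.spanningCoe_le _), hC.mapLe _, fun w hw ↦ ?_⟩
  rw [Walk.support_mapLe_eq_support] at hw
  obtain ⟨e, he, hwe⟩ := (C.mem_support_iff_exists_mem_edges_of_not_nil hC.not_nil).1 hw
  induction e with
  | h x y =>
    have := C.adj_of_mem_edges he
    simp only [Subgraph.spanningCoe_adj, Subgraph.induce_adj] at this
    rcases Sym2.mem_iff.1 hwe with rfl | rfl
    exacts [this.1, this.2.1]

lemma Walk.exists_walk_induce {S : Set V} {u v : V} (p : G.Walk u v) (hp : ∀ w ∈ p.support, w ∈ S) :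
    ∃ q : ((⊤ : G.Subgraph).induce S).spanningCoe.Walk u v, q.support = p.support := by
  refine ⟨p.transfer _ fun e he ↦ ?_, p.support_transfer _⟩
  induction e with
  | h x y =>
    exact ⟨hp _ (p.fst_mem_support_of_mem_edges he), hp _ (p.snd_mem_support_of_mem_edges he),
      p.adj_of_mem_edges he⟩

/-- Removing one vertex from a cycle leaves a connected set. -/
lemma Walk.IsCycle.exists_walk_avoiding {c b : V} {C : G.Walk c c} (hC : C.IsCycle)
    (hb : b ∈ C.support) {u v : V} (hu : u ∈ C.support) (hv : v ∈ C.support) (hub : u ≠ b)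
    (hvb : v ≠ b) : ∃ p : G.Walk u v, ∀ w ∈ p.support, w ∈ C.support ∧ w ≠ b := by
  classical
  have hC' : (C.rotate b hb).IsCycle := hC.rotate hb
  have hsupp (w : V) : w ∈ (C.rotate b hb).support ↔ w ∈ C.support := by simp
  simp only [← hsupp] at hu hv ⊢
  generalize C.rotate b hb = C' at *
  cases C' with
  | nil => simp at hC'
  | cons h p =>
    have hp := ((Walk.cons_isCycle_iff p h).1 hC').1
    have hnil : ¬ p.Nil := fun hn ↦ h.ne hn.eq.symm
    have hs := Walk.support_dropLast_concat hnil
    have hbd : b ∉ p.dropLast.support := by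
      have := hp.support_nodup
      rw [← hs] at this
      grind
    have hmem (w : V) : w ∈ p.dropLast.support ↔ w ∈ (Walk.cons h p).support ∧ w ≠ b := by
      rw [Walk.support_cons, ← hs]
      grind
    simp only [← hmem]
    have hu' := (hmem u).2 ⟨hu, hub⟩
    have hv' := (hmem v).2 ⟨hv, hvb⟩
    refine ⟨(p.dropLast.takeUntil u hu').reverse.append (p.dropLast.takeUntil v hv'),
      fun w hw ↦ ?_⟩
    rw [Walk.mem_support_append_iff, Walk.support_reverse, List.mem_reverse] at hw
    exact hw.elim (fun h ↦ p.dropLast.support_takeUntil_subset_support _ h)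
      (fun h ↦ p.dropLast.support_takeUntil_subset_support _ h)

lemma exists_adj_ne_ne_of_three_le_degree {d : V} [Fintype (G.neighborSet d)]
    (h : 3 ≤ G.degree d) (b z : V) : ∃ w, G.Adj d w ∧ w ≠ b ∧ w ≠ z := by
  classical
  have hlt : ({b, z} : Finset V).card < (G.neighborFinset d).card :=
    (Finset.card_le_two.trans_lt h : _)
  obtain ⟨w, hw, hw'⟩ := Finset.exists_mem_notMem_of_card_lt_card hlt
  exact ⟨w, by simpa using hw, by grind, by grind⟩

end SimpleGraph

open SimpleGraph

/-- If `G` is a finite simple connected graph with minimum degree at least `3`, then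
there is a cycle `C` in `G` such that `G - V(C)` is connected (the empty graph being
regarded as connected, i.e. we require preconnectedness of the induced subgraph). -/
theorem stmt14 {V : Type*} [Fintype V] (G : SimpleGraph V) [DecidableRel G.Adj]
    (hG : G.Connected) (hδ : ∀ v : V, 3 ≤ G.degree v) :
    ∃ (v : V) (C : G.Walk v v), C.IsCycle ∧
      (G.induce {w : V | w ∉ C.support}).Preconnected := by
  let P : Set V → Prop := fun Q ↦ Q.Nonempty ∧ (G.induce Q).Preconnected ∧
    ∃ (v : V) (C : G.Walk v v), C.IsCycle ∧ ∀ w ∈ C.support, w ∈ Qᶜ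
  have hstart : ∃ Q, P Q := by
    obtain ⟨v⟩ := hG.nonempty
    refine ⟨{v}, Set.singleton_nonempty v, by simp, ?_⟩
    apply exists_isCycle_of_not_isAcyclic_induce
    obtain ⟨d, hd, hdv, -⟩ := exists_adj_ne_ne_of_three_le_degree (hδ v) v v
    refine not_isAcyclic_of_two_neighbors (D := {v}ᶜ) (A := ∅) (b := v) (fun x hx z ↦ ?_)
      ⟨d, hdv⟩ (by simp) (by simp) (by simp)
    obtain ⟨w, hw, hwv, hwz⟩ := exists_adj_ne_ne_of_three_le_degree (hδ x) v z
    exact ⟨w, hwz, ⟨hx, hwv, hw⟩, .inl hwv⟩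
  obtain ⟨Q, ⟨hQne, hQ, c, C, hC, hCQ⟩, hmax⟩ := (Set.toFinite {Q | P Q}).exists_maximal hstart
  have hext {q b : V} (hq : q ∈ Q) (hb : b ∉ Q) (hqb : G.Adj q b) :
      ¬ ∃ (v : V) (C : G.Walk v v), C.IsCycle ∧ ∀ w ∈ C.support, w ∈ (Q ∪ {b})ᶜ := fun h ↦
    hb <| hmax ⟨hQne.inl, (connected_induce_union hQ (by simp) hq (Set.mem_singleton b)
      hqb).preconnected, h⟩ Set.subset_union_left (.inr rfl)
  have hextC {q b : V} (hq : q ∈ Q) (hb : b ∉ Q) (hqb : G.Adj q b) : b ∈ C.support := by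
    by_contra hbC
    refine hext hq hb hqb ⟨c, C, hC, fun w hw ↦ ?_⟩
    rintro (h | rfl)
    exacts [hCQ w hw h, hbC hw]
  refine ⟨c, C, hC, ?_⟩
  suffices {w | w ∉ C.support} = Q by rwa [this]
  refine Set.Subset.antisymm (fun u hu ↦ ?_) fun w hw hwC ↦ hCQ w hwC hw
  by_contra huQ
  obtain ⟨q₀, hq₀⟩ := hQne
  obtain ⟨p⟩ := hG.preconnected q₀ u
  obtain ⟨e, -, hq, hb⟩ := p.exists_boundary_dart Q hq₀ huQ
  set b := e.snd
  have hbC := hextC hq hb e.adj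
  refine hext hq hb e.adj (exists_isCycle_of_not_isAcyclic_induce ?_)
  refine not_isAcyclic_of_two_neighbors (D := {w | w ∉ Q ∧ w ∉ C.support})
    (A := {w | w ∈ C.support ∧ w ≠ b}) (b := b) (fun d hd z ↦ ?_) ⟨u, huQ, hu⟩
    (Set.disjoint_left.2 fun w h h' ↦ h.2 h'.1) (fun h ↦ h.2 hbC) fun x hx y hy ↦ ?_
  · obtain ⟨w, hw, hwb, hwz⟩ := exists_adj_ne_ne_of_three_le_degree (hδ d) b z
    have hwQ : w ∉ Q := fun h ↦ hd.2 (hextC h hd.1 hw.symm)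
    have hdb : d ≠ b := fun h ↦ hd.2 (h ▸ hbC)
    refine ⟨w, hwz, ⟨?_, ?_, hw⟩, ?_⟩
    · rintro (h | h); exacts [hd.1 h, hdb h]
    · rintro (h | h); exacts [hwQ h, hwb h]
    · by_cases hwC : w ∈ C.support
      exacts [.inr ⟨hwC, hwb⟩, .inl ⟨hwQ, hwC⟩]
  · obtain ⟨r, hr⟩ := hC.exists_walk_avoiding hbC hx.1 hy.1 hx.2 hy.2
    obtain ⟨r', hr'⟩ := r.exists_walk_induce (S := (Q ∪ {b})ᶜ) fun w hw ↦ by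
      rintro (h | h); exacts [hCQ w (hr w hw).1 h, (hr w hw).2 h]
    exact ⟨r', fun w hw ↦ hr w (hr' ▸ hw)⟩
end

section
/- Let G be a finite simple connected graph with minimum degree δ(G) ≥ 3. Then there exists a cycle C in G such that the graph G − E(C), obtained by deleting the edges of C, is connected. -/
open SimpleGraph

namespace SimpleGraph

variable {V : Type*} {G : SimpleGraph V}

/-- The component of a non-isolated vertex of a finite graph contains a cycle or two vertices with
at most one neighbor each. -/
lemma exists_isCycle_or_exists_ne_subsingleton_neighborSet [Finite V] {x x' : V}
    (hx : G.Adj x x') :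
    (∃ (v : V) (D : G.Walk v v), D.IsCycle ∧ G.Reachable x v) ∨
    ∃ u v : V, u ≠ v ∧ G.Reachable x u ∧ G.Reachable x v ∧
      (G.neighborSet u).Subsingleton ∧ (G.neighborSet v).Subsingleton := by
  classical
  have := Fintype.ofFinite V
  set K := G.connectedComponentMk x with hK
  have hreach (u : K) : G.Reachable x u := (ConnectedComponent.exact u.2).symm
  by_cases hac : K.toSimpleGraph.IsAcyclic
  · right
    have : Nontrivial K := ⟨⟨x, rfl⟩, ⟨x', ConnectedComponent.sound hx.symm.reachable⟩,
      fun h ↦ hx.ne (congrArg Subtype.val h)⟩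
    have htree : K.toSimpleGraph.IsTree := ⟨K.connected_toSimpleGraph, hac⟩
    have hleaf (u : K) (hu : K.toSimpleGraph.degree u = 1) :
        (G.neighborSet u).Subsingleton := by
      have hmem (a : V) (ha : G.Adj u a) : a ∈ K :=
        ConnectedComponent.sound ((hreach u).trans ha.reachable).symm
      intro a ha b hb
      obtain ⟨c, -, hc⟩ := (degree_eq_one_iff_existsUnique_adj).mp hu
      have h₁ := hc ⟨a, hmem a ha⟩ ha
      have h₂ := hc ⟨b, hmem b hb⟩ hb
      exact congrArg Subtype.val (h₁.trans h₂.symm)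
    obtain ⟨u, v, huv, hu, hv⟩ := htree.exists_ne_and_degree_eq_one
    exact ⟨u, v, fun h ↦ huv (Subtype.ext h), hreach u, hreach v, hleaf u hu, hleaf v hv⟩
  · left
    simp only [IsAcyclic, not_forall, not_not] at hac
    obtain ⟨v, D, hD⟩ := hac
    exact ⟨v, D.map K.toSimpleGraph_hom, hD.map Subtype.val_injective, hreach v⟩

namespace Walk

/-- A closed trail splits at two of its vertices into two edge-disjoint walks joining them, either
of which may be listed first. -/
lemma IsTrail.exists_walks_of_mem_support {v x y z : V} {C : G.Walk v v} (hC : C.IsTrail)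
    (hx : x ∈ C.support) (hy : y ∈ C.support) (hz : z ∈ C.support) :
    ∃ A B : G.Walk x y, A.IsTrail ∧ A.edges ⊆ C.edges ∧ B.edges ⊆ C.edges ∧
      A.edges.Disjoint B.edges ∧ z ∈ B.support := by
  classical
  have hy' : y ∈ (C.rotate x hx).support := (C.mem_support_rotate_iff x hx).2 hy
  have hz' : z ∈ (C.rotate x hx).support := (C.mem_support_rotate_iff x hx).2 hz
  have hR : (C.rotate x hx).IsTrail := hC.rotate hx
  have hsub : (C.rotate x hx).edges ⊆ C.edges := (C.rotate_edges x hx).perm.subset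
  have hdisj := hR.disjoint_edges_takeUntil_dropUntil hy'
  have hA : ((C.rotate x hx).takeUntil y hy').edges ⊆ C.edges :=
    List.Subset.trans (edges_takeUntil_subset_edges _ hy') hsub
  have hB : ((C.rotate x hx).dropUntil y hy').edges ⊆ C.edges :=
    List.Subset.trans (edges_dropUntil_subset_edges _ hy') hsub
  rw [← take_spec _ hy', mem_support_append_iff] at hz'
  rcases hz' with hz' | hz'
  · exact ⟨((C.rotate x hx).dropUntil y hy').reverse, (C.rotate x hx).takeUntil y hy',
      (hR.dropUntil hy').reverse, by simpa using hB, hA, by simpa using hdisj.symm, hz'⟩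
  · exact ⟨(C.rotate x hx).takeUntil y hy', ((C.rotate x hx).dropUntil y hy').reverse,
      hR.takeUntil hy', hA, by simpa using hB, by simpa using hdisj, by simpa using hz'⟩

/-- Two vertices of a walk that avoids `s` stay connected when `s` is deleted. -/
lemma reachable_deleteEdges_of_mem_support {a b x y : V} (p : G.Walk a b) {s : Set (Sym2 V)}
    (hp : ∀ e ∈ p.edges, e ∉ s) (hx : x ∈ p.support) (hy : y ∈ p.support) :
    (G.deleteEdges s).Reachable x y := by
  classical
  have key {z : V} (hz : z ∈ p.support) : (G.deleteEdges s).Reachable a z :=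
    ((p.takeUntil z hz).toDeleteEdges s
      fun e he ↦ hp e (p.edges_takeUntil_subset_edges hz he)).reachable
  exact (key hx).symm.trans (key hy)

/-- In a connected graph, every component of `G - E(C)` meets `C` if there are at least two. -/
lemma exists_mem_support_of_not_reachable {v a b : V} (C : G.Walk v v) (hG : G.Connected)
    (hab : ¬(G.deleteEdges {e | e ∈ C.edges}).Reachable a b) :
    ∃ z ∈ C.support, (G.deleteEdges {e | e ∈ C.edges}).Reachable a z := by
  obtain ⟨p⟩ := hG.preconnected a b
  obtain ⟨d, -, hd, hd'⟩ := p.exists_boundary_dart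
    {u | (G.deleteEdges {e | e ∈ C.edges}).Reachable a u} (Reachable.refl a) hab
  refine ⟨d.fst, ?_, hd⟩
  by_contra hC
  refine hd' (Reachable.trans hd (Adj.reachable ?_))
  exact deleteEdges_adj.2 ⟨d.adj, fun h ↦ hC (C.fst_mem_support_of_mem_edges h)⟩

/-- Deleting the edges of a cycle leaves a vertex of degree at least `3` non-isolated. -/
lemma IsCycle.exists_adj_deleteEdges [Finite V] {v : V} {C : G.Walk v v} (hC : C.IsCycle)
    {x : V} (hx : 3 ≤ (G.neighborSet x).ncard) :
    ∃ y, (G.deleteEdges {e | e ∈ C.edges}).Adj x y := by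
  by_contra! h
  have hsub : G.neighborSet x ⊆ C.toSubgraph.neighborSet x := fun y hy ↦ by
    have := h y
    rw [deleteEdges_adj, not_and_not_right] at this
    exact adj_toSubgraph_iff_mem_edges.2 (this hy)
  have hle := Set.ncard_le_ncard hsub (Set.toFinite _)
  by_cases hxC : x ∈ C.support
  · have := hC.ncard_neighborSet_toSubgraph_eq_two hxC
    lia
  · obtain ⟨y, hy⟩ : (G.neighborSet x).Nonempty := Set.nonempty_of_ncard_ne_zero (by lia)
    exact hxC (C.fst_mem_support_of_mem_edges (adj_toSubgraph_iff_mem_edges.1 (hsub hy)))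

/-- A vertex of degree at least `2` that has at most one neighbor in `G - E(C)` lies on `C`. -/
lemma mem_support_of_subsingleton_neighborSet_deleteEdges [Finite V] {v : V} (C : G.Walk v v)
    {x : V} (hx : 2 ≤ (G.neighborSet x).ncard)
    (hs : ((G.deleteEdges {e | e ∈ C.edges}).neighborSet x).Subsingleton) : x ∈ C.support := by
  by_contra hxC
  have hsub : G.neighborSet x ⊆ (G.deleteEdges {e | e ∈ C.edges}).neighborSet x := fun y hy ↦
    deleteEdges_adj.2 ⟨hy, fun h ↦ hxC (C.fst_mem_support_of_mem_edges h)⟩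
  have := Set.ncard_le_one_iff_subsingleton.2 (hs.anti hsub)
  lia

/-- If `x` and `w` lie in different components of `G - E(C)`, the component of `w` survives the
deletion of a set of edges each of which is in `C` or in the component of `x`. -/
lemma reachable_deleteEdges_of_reachable {v x w u : V} (C : G.Walk v v) {s : Set (Sym2 V)}
    (hwx : ¬(G.deleteEdges {e | e ∈ C.edges}).Reachable w x)
    (hs : ∀ a b, s(a, b) ∈ s →
      s(a, b) ∈ C.edges ∨ (G.deleteEdges {e | e ∈ C.edges}).Reachable x a)
    (hu : (G.deleteEdges {e | e ∈ C.edges}).Reachable w u) :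
    (G.deleteEdges s).Reachable w u := by
  rw [reachable_iff_reflTransGen] at hu
  induction hu with
  | refl => exact Reachable.refl w
  | @tail a b hwa hab ih =>
    refine ih.trans (Adj.reachable ?_)
    have hab' := deleteEdges_adj.1 hab
    refine deleteEdges_adj.2 ⟨hab'.1, fun h ↦ ?_⟩
    rcases hs a b h with h | h
    · exact hab'.2 h
    · exact hwx (((reachable_iff_reflTransGen w a).2 hwa).trans h.symm)

/-- If `x` and `w` lie in different components of `G - E(C)`, there is a cycle, made of edges of `C`
and of the component of `x`, whose deletion connects some vertices of these two components that
were separated before. -/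
lemma IsCycle.exists_isCycle_reachable [Finite V] {v x w : V} {C : G.Walk v v}
    (hC : C.IsCycle) (hG : G.Connected) (hδ : ∀ v, 3 ≤ (G.neighborSet v).ncard)
    (hwx : ¬(G.deleteEdges {e | e ∈ C.edges}).Reachable w x) :
    ∃ (v' : V) (D : G.Walk v' v'), D.IsCycle ∧
      (∀ a b, s(a, b) ∈ D.edges →
        s(a, b) ∈ C.edges ∨ (G.deleteEdges {e | e ∈ C.edges}).Reachable x a) ∧
      ∃ z y, (G.deleteEdges {e | e ∈ C.edges}).Reachable w z ∧
        (G.deleteEdges {e | e ∈ C.edges}).Reachable x y ∧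
        (G.deleteEdges {e | e ∈ D.edges}).Reachable z y := by
  classical
  set F := G.deleteEdges {e | e ∈ C.edges} with hF
  have hle : F ≤ G := deleteEdges_le _
  have hnotC {e : Sym2 V} (he : e ∈ F.edgeSet) : e ∉ C.edges := by
    rw [hF, edgeSet_deleteEdges] at he
    exact he.2
  have hreach {a b p q : V} (P : F.Walk p q) (hp : F.Reachable x p) (h : s(a, b) ∈ P.edges) :
      F.Reachable x a :=
    hp.trans (P.takeUntil a (P.fst_mem_support_of_mem_edges h)).reachable
  obtain ⟨z, hzC, hwz⟩ := C.exists_mem_support_of_not_reachable hG hwx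
  obtain ⟨x', hx'⟩ := hC.exists_adj_deleteEdges (hδ x)
  rcases exists_isCycle_or_exists_ne_subsingleton_neighborSet hx' with
    ⟨v', D, hD, hxv'⟩ | ⟨p, q, hpq, hxp, hxq, hp, hq⟩
  · obtain ⟨y, hyC, hxy⟩ := C.exists_mem_support_of_not_reachable hG (fun h ↦ hwx h.symm)
    refine ⟨v', D.mapLe hle, hD.mapLe hle, fun a b h ↦ ?_, z, y, hwz, hxy, ?_⟩
    · rw [edges_mapLe_eq_edges] at h
      exact .inr (hreach D hxv' h)
    · refine C.reachable_deleteEdges_of_mem_support (fun e he h ↦ ?_) hzC hyC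
      rw [Set.mem_ofPred, edges_mapLe_eq_edges] at h
      exact hnotC (D.edges_subset_edgeSet h) he
  · have hpC := C.mem_support_of_subsingleton_neighborSet_deleteEdges
      (le_trans (by lia) (hδ p)) hp
    have hqC := C.mem_support_of_subsingleton_neighborSet_deleteEdges
      (le_trans (by lia) (hδ q)) hq
    obtain ⟨A, B, hA, hAC, hBC, hAB, hzB⟩ :=
      hC.isTrail.exists_walks_of_mem_support hpC hqC hzC
    obtain ⟨P, hP⟩ := (hxp.symm.trans hxq).exists_isPath
    set D := A.append (P.mapLe hle).reverse with hDdef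
    have hDmem (e : Sym2 V) : e ∈ D.edges ↔ e ∈ A.edges ∨ e ∈ P.edges := by
      simp [hDdef]
    have hDtrail : D.IsTrail := by
      rw [hDdef, isTrail_append]
      refine ⟨hA, (hP.mapLe hle).isTrail.reverse, fun e heA heP ↦ ?_⟩
      rw [edges_reverse, List.mem_reverse, edges_mapLe_eq_edges] at heP
      exact hnotC (P.edges_subset_edgeSet heP) (hAC heA)
    have hDnil : D ≠ nil := by
      intro h
      have hlen := congrArg length h
      rw [hDdef, length_append, length_nil] at hlen
      exact hpq (eq_of_length_eq_zero (p := A) (by lia))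
    refine ⟨p, D.cycleBypass, hDtrail.isCycle_cycleBypass hDnil, fun a b h ↦ ?_, z, p, hwz, hxp, ?_⟩
    · exact ((hDmem _).1 (D.edges_cycleBypass_subset_edges h)).imp (hAC ·) (hreach P hxp)
    · refine B.reachable_deleteEdges_of_mem_support (fun e he h ↦ ?_) hzB B.start_mem_support
      rcases (hDmem e).1 (D.edges_cycleBypass_subset_edges h) with h | h
      · exact hAB h he
      · exact hnotC (P.edges_subset_edgeSet h) (hBC he)

end Walk

end SimpleGraph

/-- If `G` is a finite simple connected graph with minimum degree at least `3`, then
there is a cycle `C` in `G` such that `G - E(C)` is connected. -/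
theorem stmt15 {V : Type*} [Fintype V] (G : SimpleGraph V) [DecidableRel G.Adj]
    (hG : G.Connected) (hδ : ∀ v : V, 3 ≤ G.degree v) :
    ∃ (v : V) (C : G.Walk v v), C.IsCycle ∧
      (G.deleteEdges {e : Sym2 V | e ∈ C.edges}).Connected := by
  have hδ' (v : V) : 3 ≤ (G.neighborSet v).ncard := by
    rw [Set.ncard_eq_toFinset_card']
    exact hδ v
  obtain ⟨x⟩ := hG.nonempty
  obtain ⟨v₀, C₀, hC₀⟩ : ∃ (v : V) (C : G.Walk v v), C.IsCycle := by
    obtain ⟨x', hx'⟩ : (G.neighborSet x).Nonempty :=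
      Set.nonempty_of_ncard_ne_zero (by have := hδ' x; lia)
    rcases exists_isCycle_or_exists_ne_subsingleton_neighborSet hx' with
      ⟨v, D, hD, -⟩ | ⟨u, -, -, -, -, hu, -⟩
    · exact ⟨v, D, hD⟩
    · have := Set.ncard_le_one_iff_subsingleton.2 hu
      have := hδ' u
      lia
  obtain ⟨S, ⟨v, C, w, hC, rfl⟩, hmax⟩ := (Set.toFinite
    {S : Set V | ∃ (v : V) (C : G.Walk v v) (w : V), C.IsCycle ∧
      S = {u | (G.deleteEdges {e | e ∈ C.edges}).Reachable w u}}).exists_maximal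
    ⟨_, v₀, C₀, v₀, hC₀, rfl⟩
  refine ⟨v, C, hC, (connected_iff_exists_forall_reachable _).2 ⟨w, ?_⟩⟩
  by_contra! ⟨x, hwx⟩
  obtain ⟨v', D, hD, hDC, z, y, hwz, hxy, hzy⟩ := hC.exists_isCycle_reachable hG hδ' hwx
  have hsub (u : V) (hu : (G.deleteEdges {e | e ∈ C.edges}).Reachable w u) :
      (G.deleteEdges {e | e ∈ D.edges}).Reachable w u :=
    C.reachable_deleteEdges_of_reachable hwx hDC hu
  have hwy : (G.deleteEdges {e | e ∈ C.edges}).Reachable w y :=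
    hmax ⟨v', D, w, hD, rfl⟩ hsub ((hsub z hwz).trans hzy)
  exact hwx (hwy.trans hxy.symm)
end

section
/- For integers k and n with 1 ≤ k ≤ n − 1, the minimum size (number of edges) of a connected graph G of order n with rvd(G) = k is n + k − 2. That is: every connected graph of order n and size n + k − 2 satisfies rvd(G) ≤ k; every connected graph of order n with rvd(G) = k has at least n + k − 2 edges; and there exists a connected graph of order n and size n + k − 2 with rvd(G) = k. -/
open SimpleGraph

/-- `S` is a rainbow cut, within the vertex set `U`, between `x` and `y`. The set `P` is the side
of `x`: every edge leaving it, other than `xy`, ends in `S`. -/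
def RainbowSep {V : Type*} (G : SimpleGraph V) (U : Finset V) (c : V → ℕ) (x y : V) : Prop :=
  ∃ S P : Finset V, S ⊆ U ∧ P ⊆ U ∧ x ∉ S ∧ y ∉ S ∧ x ∈ P ∧ y ∉ P ∧
    (∀ p ∈ P, ∀ q ∈ U, G.Adj p q → q ∈ P ∨ q ∈ S ∨ (p = x ∧ q = y)) ∧
    (¬ G.Adj x y → Set.InjOn c S) ∧
    (G.Adj x y → Set.InjOn c (insert x (S : Set V)) ∨ Set.InjOn c (insert y (S : Set V)))

/-- `c` is a rainbow vertex-disconnection coloring of the subgraph induced on `U`. -/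
def RainbowOn {V : Type*} (G : SimpleGraph V) (U : Finset V) (c : V → ℕ) : Prop :=
  ∀ x ∈ U, ∀ y ∈ U, x ≠ y → RainbowSep G U c x y

/-- The subgraph induced on `U` is connected. -/
def ConnOn {V : Type*} (G : SimpleGraph V) (U : Finset V) : Prop :=
  U.Nonempty ∧ ∀ P ⊆ U, P.Nonempty → (∀ p ∈ P, ∀ q ∈ U, G.Adj p q → q ∈ P) → P = U

/-- The number of edges of the subgraph induced on `U`. -/
def sizeOn {V : Type*} [DecidableEq V] (G : SimpleGraph V) [DecidableRel G.Adj]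
    (U : Finset V) : ℕ :=
  (U.sym2.filter (· ∈ G.edgeSet)).card

section

variable {V : Type*} {G : SimpleGraph V} {U : Finset V} {c : V → ℕ}

theorem RainbowOn.refine {c' : V → ℕ} (h : RainbowOn G U c)
    (hc : ∀ u ∈ U, ∀ w ∈ U, c' u = c' w → c u = c w) : RainbowOn G U c' := by
  intro x hx y hy hxy
  obtain ⟨S, P, hS, hP, hxS, hyS, hxP, hyP, hcl, h1, h2⟩ := h x hx y hy hxy
  have key : ∀ T : Set V, T ⊆ U → Set.InjOn c T → Set.InjOn c' T := fun T hT hi u hu w hw huw =>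
    hi hu hw (hc u (hT hu) w (hT hw) huw)
  have hS' : (S : Set V) ⊆ U := by exact_mod_cast hS
  exact ⟨S, P, hS, hP, hxS, hyS, hxP, hyP, hcl, fun h => key _ hS' (h1 h),
    fun h => (h2 h).imp (key _ (Set.insert_subset hx hS')) (key _ (Set.insert_subset hy hS'))⟩

theorem RainbowOn.of_const (h : RainbowOn G U fun _ => 0) : RainbowOn G U c := by
  intro x hx y hy hxy
  obtain ⟨S, P, hS, hP, hxS, hyS, hxP, hyP, hcl, h1, h2⟩ := h x hx y hy hxy
  have key : ∀ T : Set V, Set.InjOn (fun _ : V => 0) T → Set.InjOn c T :=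
    fun T hi u hu w hw _ => hi hu hw rfl
  exact ⟨S, P, hS, hP, hxS, hyS, hxP, hyP, hcl, fun h => key _ (h1 h),
    fun h => (h2 h).imp (key _) (key _)⟩

theorem ConnOn.exists_rank (h : ConnOn G U) {b : V} (hb : b ∈ U) :
    ∃ r : V → ℕ, ∀ x ∈ U, x ≠ b → ∃ q ∈ U, G.Adj x q ∧ r q < r x := by
  classical
  let R : ℕ → V → Prop := fun n => Nat.rec (motive := fun _ => V → Prop) (fun x => x = b)
    (fun _ ih x => ∃ q ∈ U, G.Adj x q ∧ ih q) n
  have hR : U.filter (fun x => ∃ n, R n x) = U := by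
    refine h.2 _ (Finset.filter_subset _ _) ⟨b, by simpa [hb] using ⟨0, rfl⟩⟩ ?_
    intro p hp q hq hpq
    rw [Finset.mem_filter] at hp ⊢
    obtain ⟨hp, n, hn⟩ := hp
    exact ⟨hq, n + 1, p, hp, hpq.symm, hn⟩
  refine ⟨fun x => sInf {n | R n x}, fun x hx hxb => ?_⟩
  rw [← hR, Finset.mem_filter] at hx
  have hmem : sInf {n | R n x} ∈ {n | R n x} := Nat.sInf_mem hx.2
  change R (sInf {n | R n x}) x at hmem
  rcases hn : sInf {n | R n x} with _ | n
  · rw [hn] at hmem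
    exact absurd hmem hxb
  · rw [hn] at hmem
    obtain ⟨q, hq, hxq, hqn⟩ := hmem
    exact ⟨q, hq, hxq, by
      have : sInf {n | R n q} ≤ n := Nat.sInf_le hqn
      simp only [hn]
      omega⟩

variable [DecidableEq V]

theorem RainbowSep.symm {x y : V} (hy : y ∈ U) (h : RainbowSep G U c x y) :
    RainbowSep G U c y x := by
  obtain ⟨S, P, hS, hP, hxS, hyS, hxP, hyP, hcl, h1, h2⟩ := h
  refine ⟨S, U \ (P ∪ S), hS, Finset.sdiff_subset, hyS, hxS, by simp [*], by simp [*], ?_,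
    fun h => h1 fun h' => h h'.symm, fun h => (h2 h.symm).symm⟩
  intro p hp q hq hpq
  have := hcl q
  have := hpq.symm
  grind

theorem RainbowSep.union_left {A B : Finset V} {a x y : V} (haA : a ∈ A)
    (hAB : ∀ v ∈ A, v ∈ B → v = a)
    (hcross : ∀ p ∈ A, ∀ q ∈ B, G.Adj p q → p = a ∨ q = a) (hy : y ∈ A)
    (h : RainbowSep G A c x y) : RainbowSep G (A ∪ B) c x y := by
  obtain ⟨S, P, hS, hP, hxS, hyS, hxP, hyP, hcl, h1, h2⟩ := h
  by_cases haP : a ∈ P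
  · refine ⟨S, P ∪ B, by grind, by grind, hxS, hyS, by grind, by grind, ?_, h1, h2⟩
    intro p hp q hq hpq
    have := hpq.symm
    grind
  · refine ⟨S, P, by grind, by grind, hxS, hyS, hxP, hyP, ?_, h1, h2⟩
    intro p hp q hq hpq
    grind

theorem RainbowOn.union {A B : Finset V} {a : V} (haA : a ∈ A) (haB : a ∈ B)
    (hAB : ∀ v ∈ A, v ∈ B → v = a)
    (hcross : ∀ p ∈ A, ∀ q ∈ B, G.Adj p q → p = a ∨ q = a)
    (hA : RainbowOn G A c) (hB : RainbowOn G B c) : RainbowOn G (A ∪ B) c := by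
  have hcross' : ∀ p ∈ B, ∀ q ∈ A, G.Adj p q → p = a ∨ q = a :=
    fun p hp q hq h => (hcross q hq p hp h.symm).symm
  have mixed : ∀ x ∈ A, x ∉ B → ∀ y ∈ B, y ∉ A → RainbowSep G (A ∪ B) c x y := by
    intro x hx hxB y hy hyA
    refine ⟨{a}, A.erase a, by grind, by grind, by grind, by grind, by grind, by grind, ?_,
      by simp, fun h => ?_⟩
    · intro p hp q hq hpq
      grind
    · grind
  intro x hx y hy hxy
  by_cases hxA : x ∈ A <;> by_cases hyA : y ∈ A
  · exact (hA x hxA y hyA hxy).union_left haA hAB hcross hyA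
  · by_cases hxB : x ∈ B
    · rw [Finset.union_comm]
      exact (hB x hxB y (by grind) hxy).union_left haB (by grind) hcross' (by grind)
    · exact mixed x hxA hxB y (by grind) hyA
  · by_cases hyB : y ∈ B
    · rw [Finset.union_comm]
      exact (hB x (by grind) y hyB hxy).union_left haB (by grind) hcross' hyB
    · exact (mixed y hyA hyB x (by grind) hxA).symm (by grind)
  · rw [Finset.union_comm]
    exact (hB x (by grind) y (by grind) hxy).union_left haB (by grind) hcross' (by grind)

theorem rainbowOn_pair (u v : V) : RainbowOn G {u, v} c := by
  intro x hx y hy hxy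
  exact ⟨∅, {x}, by simp, by simpa using hx, by simp, by simp, by simp, by simpa using hxy.symm,
    by grind, by simp, by simp⟩

/-- Adding a vertex whose neighborhood is rainbow: that neighborhood separates it from any other
vertex. -/
theorem rainbowSep_of_neighbors [DecidableRel G.Adj] {v y : V} (hv : v ∉ U) (hy : y ∈ U)
    (hN : Set.InjOn c (U.filter (G.Adj v))) : RainbowSep G (insert v U) c v y := by
  refine ⟨(U.filter (G.Adj v)).erase y, {v}, by grind, by simp, by simp, by simp, by simp,
    by grind, ?_, fun _ => hN.mono (by simp), fun h => .inr (hN.mono ?_)⟩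
  · intro p hp q hq hpq
    have := hpq.ne
    grind
  · intro z hz
    grind

theorem exists_injOn_lt_card (W : Finset V) :
    ∃ g : V → ℕ, Set.InjOn g W ∧ ∀ w ∈ W, g w < W.card := by
  refine ⟨fun w => if h : w ∈ W then W.equivFin ⟨w, h⟩ else 0, ?_, ?_⟩
  · intro u hu w hw h
    have hu' : u ∈ W := hu
    have hw' : w ∈ W := hw
    simp only [hu', hw', dif_pos] at h
    simpa using W.equivFin.injective (Fin.ext h)
  · intro w hw
    simp [hw]

theorem RainbowOn.insert_of_ne [DecidableRel G.Adj] {v a b : V} {k : ℕ} (hv : v ∉ U)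
    (h : RainbowOn G U c) (hk : ∀ u ∈ U, c u < k) (ha : a ∈ U.filter (G.Adj v))
    (hb : b ∈ U.filter (G.Adj v)) (hab : c a ≠ c b) :
    ∃ c' : V → ℕ, RainbowOn G (insert v U) c' ∧
      (∀ u ∈ insert v U, c' u + 1 < k + (U.filter (G.Adj v)).card) ∧ ∀ u ∈ U, c' v ≠ c' u := by
  have hne : a ≠ b := fun h => hab (by rw [h])
  set N := U.filter (G.Adj v) with hNdef
  set W := (N.erase a).erase b with hW
  obtain ⟨g, hg, hgW⟩ := exists_injOn_lt_card W
  have hcard : W.card + 2 = N.card := by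
    have h1 : W.card + 1 = (N.erase a).card := Finset.card_erase_add_one (by grind)
    have h2 := Finset.card_erase_add_one ha
    omega
  have hNU : ∀ u ∈ N, u ∈ U := by grind
  have hWN : ∀ u ∈ W, u ∈ N := by grind
  have hNW : ∀ u ∈ N, u ∉ W → u = a ∨ u = b := by grind
  clear_value W N
  set c' : V → ℕ := fun u => if u = v then k else if u ∈ W then k + 1 + g u else c u with hc'
  have hvW : v ∉ W := fun h => hv (hNU _ (hWN _ h))
  have c'v : c' v = k := by simp [hc']
  have c'W : ∀ u ∈ W, c' u = k + 1 + g u := by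
    intro u hu
    have : u ≠ v := by grind
    simp [hc', hu, this]
  have c'U : ∀ u ∈ U, u ∉ W → c' u = c u := by
    intro u hu hw
    have : u ≠ v := by grind
    simp [hc', hw, this]
  clear_value c'
  have hfresh : ∀ u ∈ U, c' v ≠ c' u := by
    intro u hu
    by_cases hw : u ∈ W
    · have := c'W u hw
      omega
    · have := c'U u hu hw
      have := hk u hu
      omega
  have href : ∀ u ∈ U, ∀ w ∈ U, c' u = c' w → c u = c w := by
    intro u hu w hw huw
    have h1 := hk u hu
    have h2 := hk w hw
    by_cases hu' : u ∈ W <;> by_cases hw' : w ∈ W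
    · rw [c'W u hu', c'W w hw'] at huw
      rw [hg hu' hw' (by omega)]
    · rw [c'W u hu', c'U w hw hw'] at huw
      omega
    · rw [c'U u hu hu', c'W w hw'] at huw
      omega
    · rwa [c'U u hu hu', c'U w hw hw'] at huw
  have hNinj : Set.InjOn c' N := by
    intro u hu w hw huw
    have hu0 : u ∈ N := hu
    have hw0 : w ∈ N := hw
    have h1 := hk u (hNU u hu)
    have h2 := hk w (hNU w hw)
    by_cases hu' : u ∈ W <;> by_cases hw' : w ∈ W
    · rw [c'W u hu', c'W w hw'] at huw
      exact hg hu' hw' (by omega)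
    · rw [c'W u hu', c'U w (hNU w hw) hw'] at huw
      omega
    · rw [c'U u (hNU u hu) hu', c'W w hw'] at huw
      omega
    · rw [c'U u (hNU u hu) hu', c'U w (hNU w hw) hw'] at huw
      grind
  refine ⟨c', ?_, ?_, hfresh⟩
  · have hold : ∀ x ∈ U, ∀ y ∈ U, x ≠ y → RainbowSep G (insert v U) c' x y := by
      intro x hx y hy hxy
      obtain ⟨S, P, hS, hP, hxS, hyS, hxP, hyP, hcl, h1, h2⟩ := h.refine href x hx y hy hxy
      have key : ∀ T : Set V, T ⊆ U → Set.InjOn c' T → Set.InjOn c' (insert v T) := by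
        intro T hT hi
        rw [Set.injOn_insert (fun h => hv (hT h))]
        refine ⟨hi, ?_⟩
        rintro ⟨u, hu, huv⟩
        exact hfresh u (hT hu) huv.symm
      have hS' : (S : Set V) ⊆ U := by exact_mod_cast hS
      refine ⟨insert v S, P, by grind, by grind, by grind, by grind, hxP, hyP, ?_, ?_, ?_⟩
      · intro p hp q hq hpq
        grind
      · intro h
        rw [Finset.coe_insert]
        exact key _ hS' (h1 h)
      · intro h
        rw [Finset.coe_insert, Set.insert_comm, Set.insert_comm y]
        exact (h2 h).imp (key _ (Set.insert_subset hx hS')) (key _ (Set.insert_subset hy hS'))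
    intro x hx y hy hxy
    rw [Finset.mem_insert] at hx hy
    rcases hx with rfl | hx <;> rcases hy with rfl | hy
    · exact absurd rfl hxy
    · exact rainbowSep_of_neighbors hv hy (hNdef ▸ hNinj)
    · exact (rainbowSep_of_neighbors hv hx (hNdef ▸ hNinj)).symm (by simp [hx])
    · exact hold x hx y hy hxy
  · intro u hu
    rw [Finset.mem_insert] at hu
    rcases hu with rfl | hu
    · omega
    · by_cases hw : u ∈ W
      · have := c'W u hw
        have := hgW u hw
        omega
      · have := c'U u hu hw
        have := hk u hu
        omega

theorem RainbowOn.insert_of_const [DecidableRel G.Adj] {v b : V} (hv : v ∉ U) (hb : b ∈ U)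
    (hconn : ConnOn G U) (h : RainbowOn G U fun _ => 0)
    (hd : 2 ≤ (U.filter (G.Adj v)).card) :
    ∃ c' : V → ℕ, RainbowOn G (insert v U) c' ∧
      (∀ u ∈ insert v U, c' u < (U.filter (G.Adj v)).card) ∧ c' v ≠ c' b := by
  obtain ⟨r, hr⟩ := hconn.exists_rank hb
  set N := U.filter (G.Adj v) with hNdef
  have hNe : (N.erase b).Nonempty := by
    rw [← Finset.card_pos]
    have := Finset.pred_card_le_card_erase (s := N) (a := b)
    omega
  obtain ⟨u, hu, humax⟩ := Finset.exists_max_image (N.erase b) r hNe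
  have huN : u ∈ N := Finset.mem_of_mem_erase hu
  have hub : u ≠ b := Finset.ne_of_mem_erase hu
  have hreach : ∀ Q : Finset V, (∀ p ∈ Q, ∀ q ∈ U, G.Adj p q → q ∈ Q ∨ q = u) →
      ∀ x ∈ N, x ∈ Q → x ≠ u → b ∈ Q := by
    intro Q hQ x hxN hxQ hxu
    by_cases hxb : x = b
    · exact hxb ▸ hxQ
    have main : ∀ n, ∀ x ∈ U, x ∈ Q → x ≠ u → r x ≤ r u → r x = n → b ∈ Q := by
      intro n
      induction n using Nat.strong_induction_on with
      | _ n ih =>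
        intro x hx hxQ hxu hxr hn
        by_cases hxb : x = b
        · exact hxb ▸ hxQ
        obtain ⟨q, hq, hxq, hlt⟩ := hr x hx hxb
        have hqu : q ≠ u := by
          rintro rfl
          omega
        exact ih (r q) (by omega) q hq ((hQ x hxQ q hq hxq).resolve_right hqu) hqu (by omega) rfl
    exact main _ x (by grind) hxQ hxu (humax x (Finset.mem_erase.2 ⟨hxb, hxN⟩)) rfl
  obtain ⟨g, hg, hgW⟩ := exists_injOn_lt_card (N.erase u)
  have hcard := Finset.card_erase_add_one huN
  set c' : V → ℕ := fun w => if w = v ∨ w = u then 0 else if w ∈ N then 1 + g w else 1 with hc'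
  have c'v : c' v = 0 := by simp [hc']
  have c'u : c' u = 0 := by simp [hc']
  have c'N : ∀ w ∈ N, w ≠ u → c' w = 1 + g w := by
    intro w hw hwu
    have : w ≠ v := by grind
    simp [hc', hw, hwu, this]
  have c'U : ∀ w ∈ U, w ≠ u → c' w ≠ 0 := by
    intro w hw hwu
    have : w ≠ v := by grind
    simp only [hc', this, hwu, or_self, if_false]
    split_ifs <;> omega
  have c'lt : ∀ w, c' w < N.card := by
    intro w
    simp only [hc']
    split_ifs with h1 h2
    · omega
    · have := hgW w (by grind)
      omega
    · omega
  have hNU : ∀ u ∈ N, u ∈ U := by grind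
  have hNv : ∀ w ∈ U, G.Adj v w → w ∈ N := by grind
  have hNinj : Set.InjOn c' N := by
    intro w hw z hz hwz
    have hw0 : w ∈ N := hw
    have hz0 : z ∈ N := hz
    by_cases hwu : w = u <;> by_cases hzu : z = u
    · rw [hwu, hzu]
    · have := c'N z hz0 hzu
      rw [hwu] at hwz
      omega
    · have := c'N w hw0 hwu
      rw [hzu] at hwz
      omega
    · rw [c'N w hw0 hwu, c'N z hz0 hzu] at hwz
      exact hg (by simp [hw0, hwu]) (by simp [hz0, hzu]) (by omega)
  clear_value c'
  refine ⟨c', ?_, fun w _ => c'lt w, fun h => c'U b hb hub.symm (by omega)⟩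
  have hold : ∀ x ∈ U, ∀ y ∈ U, x ≠ y → RainbowSep G (insert v U) c' x y := by
    intro x hx y hy hxy
    obtain ⟨S, P, hS, hP, hxS, hyS, hxP, hyP, hcl, h1, h2⟩ := h x hx y hy hxy
    by_cases hxyA : G.Adj x y
    · have hS0 : ∀ s, s ∉ S := by
        intro s hs
        rcases h2 hxyA with hi | hi
        · have := hi (Set.mem_insert_of_mem x (Finset.mem_coe.2 hs)) (Set.mem_insert x _) rfl
          exact hxS (this ▸ hs)
        · have := hi (Set.mem_insert_of_mem y (Finset.mem_coe.2 hs)) (Set.mem_insert y _) rfl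
          exact hyS (this ▸ hs)
      have pairInj : ∀ w ∈ U, w ≠ u → Set.InjOn c' {w, v} := by
        intro w hw hwu
        have := c'U w hw hwu
        intro s hs t ht hst
        rcases hs with rfl | rfl <;> rcases ht with rfl | rfl <;> grind
      refine ⟨{v}, P, by simp, by grind, by grind, by grind, hxP, hyP, by grind,
        fun h => absurd hxyA h, fun _ => ?_⟩
      rw [Finset.coe_singleton]
      by_cases hxu : x = u
      · exact .inr (pairInj y hy (by grind))
      · exact .inl (pairInj x hx hxu)
    have hSsub : ∀ s ∈ S, ∀ t ∈ S, s = t := fun s hs t ht =>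
      h1 hxyA (Finset.mem_coe.2 hs) (Finset.mem_coe.2 ht) rfl
    by_cases huS : u ∈ S
    · have hPcl : ∀ p ∈ P, ∀ q ∈ U, G.Adj p q → q ∈ P ∨ q = u := by
        intro p hp q hq hpq
        rcases hcl p hp q hq hpq with h | h | ⟨rfl, rfl⟩
        · exact .inl h
        · exact .inr (hSsub q h u huS)
        · exact absurd hpq hxyA
      have hnot : ¬ (x ∈ N ∧ y ∈ N) := by
        rintro ⟨hxN, hyN⟩
        have hb1 := hreach P hPcl x hxN hxP (by grind)
        have hb2 := hreach ((U \ P).erase u) (by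
          intro p hp q hq hpq
          have := hPcl q
          have := hpq.symm
          grind) y hyN (by grind) (by grind)
        grind
      have hSinj : Set.InjOn c' ((N.erase x).erase y : Finset V) :=
        hNinj.mono (by
          intro z hz
          grind)
      by_cases hxN : x ∈ N
      · have hyN : y ∉ N := fun h => hnot ⟨hxN, h⟩
        refine ⟨(N.erase x).erase y, insert v (P \ (N.erase x).erase y), by grind, by grind,
          by grind, by grind, by grind, by grind, ?_, fun _ => hSinj, fun h => absurd h hxyA⟩
        intro p hp q hq hpq
        have := hpq.ne
        have := hPcl p
        grind
      · refine ⟨(N.erase x).erase y, P \ (N.erase x).erase y, by grind, by grind,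
          by grind, by grind, by grind, by grind, ?_, fun _ => hSinj, fun h => absurd h hxyA⟩
        intro p hp q hq hpq
        have hqp := hpq.symm
        have hPp := hPcl p
        have hpN := hNv p
        clear_value N
        clear hreach hr humax hNe hu hcl h h1 h2 hSinj hPcl hNv c'N c'U c'lt hgW hNU
        grind
    · refine ⟨insert v S, P, by grind, by grind, by grind, by grind, hxP, hyP, by grind,
        fun _ => ?_, fun h => absurd h hxyA⟩
      intro s hs t ht hst
      have hs' : s = v ∨ s ∈ S := by simpa using hs
      have ht' : t = v ∨ t ∈ S := by simpa using ht
      have := c'U s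
      have := c'U t
      grind
  intro x hx y hy hxy
  rw [Finset.mem_insert] at hx hy
  rcases hx with rfl | hx <;> rcases hy with rfl | hy
  · exact absurd rfl hxy
  · exact rainbowSep_of_neighbors hv hy (hNdef ▸ hNinj)
  · exact (rainbowSep_of_neighbors hv hx (hNdef ▸ hNinj)).symm (by simp [hx])
  · exact hold x hx y hy hxy

theorem sizeOn_insert [DecidableRel G.Adj] {v : V} (hv : v ∉ U) :
    sizeOn G (insert v U) = sizeOn G U + (U.filter (G.Adj v)).card := by
  have himg : ((U.filter (G.Adj v)).image fun w => s(v, w)).card = (U.filter (G.Adj v)).card := by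
    apply Finset.card_image_of_injective
    intro a b h
    exact Sym2.congr_right.1 h
  unfold sizeOn
  rw [← himg, ← Finset.card_union_of_disjoint]
  · congr 1
    ext e
    induction e with
    | _ p q =>
      simp only [Finset.mem_filter, Finset.mem_union, Finset.mem_image, Finset.mk_mem_sym2_iff,
        Finset.mem_insert, SimpleGraph.mem_edgeSet, Sym2.eq_iff]
      have := G.adj_comm p q
      have := fun h : G.Adj p q => h.ne
      grind
  · rw [Finset.disjoint_left]
    intro e he he'
    simp only [Finset.mem_filter, Finset.mem_image, Finset.mem_sym2_iff] at he he'
    obtain ⟨w, -, rfl⟩ := he'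
    exact hv (he.1 v (by simp))

theorem sizeOn_union [DecidableRel G.Adj] {A B : Finset V} {a : V}
    (hAB : ∀ v ∈ A, v ∈ B → v = a) (haA : a ∈ A) (haB : a ∈ B)
    (hcross : ∀ p ∈ A, ∀ q ∈ B, G.Adj p q → p = a ∨ q = a) :
    sizeOn G (A ∪ B) = sizeOn G A + sizeOn G B := by
  unfold sizeOn
  rw [← Finset.card_union_of_disjoint]
  · congr 1
    ext e
    induction e with
    | _ p q =>
      simp only [Finset.mem_filter, Finset.mem_union, Finset.mk_mem_sym2_iff,
        SimpleGraph.mem_edgeSet]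
      have := fun h : G.Adj p q => h.symm
      grind
  · rw [Finset.disjoint_left]
    intro e he he'
    induction e with
    | _ p q =>
      simp only [Finset.mem_filter, Finset.mk_mem_sym2_iff, SimpleGraph.mem_edgeSet] at he he'
      have := he.2.ne
      grind

theorem ConnOn.insert_part {a : V} {P : Finset V} (h : ConnOn G U) (ha : a ∈ U)
    (hP : P ⊆ U.erase a) (hcl : ∀ p ∈ P, ∀ q ∈ U.erase a, G.Adj p q → q ∈ P) :
    ConnOn G (insert a P) := by
  refine ⟨by simp, fun Q hQ hQne hQcl => ?_⟩
  by_cases haQ : a ∈ Q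
  · have hU := h.2 (Q ∪ (U \ P)) (by grind) ⟨a, by simp [haQ]⟩ (by
      intro p hp q hq hpq
      have := hpq.symm
      have := hcl q
      have := hQcl p
      grind)
    grind
  · have hU := h.2 Q (by grind) hQne (by
      intro p hp q hq hpq
      grind)
    grind

theorem ConnOn.bounds [DecidableRel G.Adj] : ∀ (n : ℕ) (U : Finset V), U.card = n → ConnOn G U →
    U.card ≤ sizeOn G U + 1 ∧
    (sizeOn G U + 1 = U.card → RainbowOn G U fun _ => 0) ∧
    (U.card ≤ sizeOn G U → ∀ a ∈ U, ∀ b ∈ U, a ≠ b → ∃ c : V → ℕ, RainbowOn G U c ∧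
      (∀ u ∈ U, c u + U.card < sizeOn G U + 2) ∧ c a ≠ c b) := by
  intro n
  induction n using Nat.strong_induction_on with
  | _ n ih =>
  intro U hn hconn
  have side : ∀ a, ∀ A B : Finset V, a ∈ A → a ∈ B → (∀ v ∈ A, v ∈ B → v = a) → A ∪ B = U →
      (∀ c, RainbowOn G A c → RainbowOn G B c → RainbowOn G U c) →
      A.card + B.card = U.card + 1 → sizeOn G U = sizeOn G A + sizeOn G B →
      ConnOn G A → ConnOn G B → A.card < n → B.card < n → U.card ≤ sizeOn G U →
      ∀ b ∈ A, a ≠ b → ∃ c : V → ℕ, RainbowOn G U c ∧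
        (∀ u ∈ U, c u + U.card < sizeOn G U + 2) ∧ c a ≠ c b := by
    intro a A B haA haB hAB hUAB hglue hcard hsize hAc hBc hAn hBn h b hb hab
    obtain ⟨A1, A2, A3⟩ := ih _ hAn A rfl hAc
    obtain ⟨B1, B2, B3⟩ := ih _ hBn B rfl hBc
    have hbB : b ∉ B := fun h => hab (hAB b hb h).symm
    by_cases hBtree : sizeOn G B + 1 = B.card
    · obtain ⟨c, hc, hck, hcab⟩ := A3 (by omega) a haA b hb hab
      refine ⟨fun u => if u ∈ A then c u else 0, hglue _ (hc.refine ?_) (B2 hBtree).of_const,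
        ?_, by simpa [haA, hb] using hcab⟩
      · intro u hu w hw huw
        simpa [hu, hw] using huw
      · intro u hu
        dsimp only
        split_ifs with huA
        · have := hck u huA
          omega
        · omega
    have hB2 : ∃ b' ∈ B, a ≠ b' := by
      by_contra! hall
      have hBa : B = {a} := by grind
      rw [hBa] at hBtree
      simp [sizeOn] at hBtree
    obtain ⟨b', hb', hab'⟩ := hB2
    obtain ⟨c₂, hc₂, hck₂, hcab₂⟩ := B3 (by omega) a haB b' hb' hab'
    by_cases hAtree : sizeOn G A + 1 = A.card
    · set t : ℕ := if c₂ a = 0 then 1 else 0 with ht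
      have hta : c₂ a ≠ t := by
        rw [ht]
        split_ifs <;> omega
      have ht1 : t ≤ 1 := by
        rw [ht]
        split_ifs <;> omega
      refine ⟨fun u => if u ∈ B then c₂ u else t, hglue _ (A2 hAtree).of_const (hc₂.refine ?_),
        ?_, by simpa [haB, hbB] using hta⟩
      · intro u hu w hw huw
        simpa [hu, hw] using huw
      · intro u hu
        dsimp only
        split_ifs with huB
        · have := hck₂ u huB
          omega
        · omega
    obtain ⟨c₁, hc₁, hck₁, hcab₁⟩ := A3 (by omega) a haA b hb hab
    set t := sizeOn G U + 1 - U.card with ht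
    have h1 : ∀ u ∈ A, c₁ u < t := fun u hu => by
      have := hck₁ u hu
      omega
    have h2 : ∀ u ∈ B, c₂ u < t := fun u hu => by
      have := hck₂ u hu
      omega
    have htlt : t + U.card < sizeOn G U + 2 := by omega
    refine ⟨fun u => if u = a then t else if u ∈ A then c₁ u else c₂ u,
      hglue _ (hc₁.refine ?_) (hc₂.refine ?_), ?_, ?_⟩
    · intro u hu w hw huw
      have := h1 u hu
      have := h1 w hw
      grind
    · intro u hu w hw huw
      have := h2 u hu
      have := h2 w hw
      grind
    · intro u hu
      have := h1 u
      have := h2 u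
      dsimp only
      split_ifs <;> grind
    · have := h1 b hb
      grind
  have main : ∀ a ∈ U, 2 ≤ U.card → U.card ≤ sizeOn G U + 1 ∧
      (sizeOn G U + 1 = U.card → RainbowOn G U fun _ => 0) ∧
      (U.card ≤ sizeOn G U → ∀ b ∈ U, a ≠ b → ∃ c : V → ℕ, RainbowOn G U c ∧
        (∀ u ∈ U, c u + U.card < sizeOn G U + 2) ∧ c a ≠ c b) := by
    intro a ha h2
    have hcardU := Finset.card_erase_add_one ha
    by_cases hcut : ConnOn G (U.erase a)
    · obtain ⟨ih1, ih2, ih3⟩ := ih _ (by omega) (U.erase a) rfl hcut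
      have hins : insert a (U.erase a) = U := Finset.insert_erase ha
      have haU : a ∉ U.erase a := by simp
      have hsize := sizeOn_insert (G := G) haU
      rw [hins] at hsize
      have hd : 1 ≤ ((U.erase a).filter (G.Adj a)).card := by
        rw [Nat.one_le_iff_ne_zero]
        intro h0
        rw [Finset.card_eq_zero] at h0
        have := hconn.2 {a} (by simpa using ha) (by simp) (by
          intro p hp q hq hpq
          rw [Finset.mem_singleton] at hp
          subst hp
          have : q ∈ (U.erase p).filter (G.Adj p) := by simp [hq, hpq, hpq.ne.symm]
          simp [h0] at this)
        rw [← this] at h2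
        simp at h2
      have leaf : ((U.erase a).filter (G.Adj a)).card = 1 → ∀ c, RainbowOn G (U.erase a) c →
          RainbowOn G U c := by
        intro h1 c hc
        obtain ⟨u, hu⟩ := Finset.card_eq_one.1 h1
        have huU : u ∈ U.erase a ∧ G.Adj a u := by
          have : u ∈ (U.erase a).filter (G.Adj a) := by simp [hu]
          simpa using this
        have := RainbowOn.union (G := G) (A := U.erase a) (B := {u, a}) (a := u) huU.1 (by simp)
          (by grind) (by
            intro p hp q hq hpq
            rcases Finset.mem_insert.1 hq with rfl | hqa
            · exact .inr rfl
            · rw [Finset.mem_singleton] at hqa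
              subst hqa
              have : p ∈ (U.erase q).filter (G.Adj q) := Finset.mem_filter.2 ⟨hp, hpq.symm⟩
              rw [hu] at this
              exact .inl (Finset.mem_singleton.1 this)) hc (rainbowOn_pair u a)
        convert this using 1
        grind
      refine ⟨by omega, fun h => leaf (by omega) _ (ih2 (by omega)), fun h b hb hab => ?_⟩
      have hbU : b ∈ U.erase a := by grind
      by_cases hd1 : ((U.erase a).filter (G.Adj a)).card = 1
      · have hpos : 0 < sizeOn G (U.erase a) := by omega
        obtain ⟨e, he⟩ := Finset.card_pos.1 hpos
        induction e with
        | _ p q =>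
          simp only [Finset.mem_filter, Finset.mk_mem_sym2_iff, SimpleGraph.mem_edgeSet] at he
          obtain ⟨c, hc, hck, -⟩ := ih3 (by omega) p he.1.1 q he.1.2 he.2.ne
          have hagree : ∀ u ∈ U.erase a,
              Function.update c a (if c b = 0 then 1 else 0) u = c u := by
            intro u hu
            rw [Function.update_of_ne (Finset.ne_of_mem_erase hu)]
          refine ⟨Function.update c a (if c b = 0 then 1 else 0),
            leaf hd1 _ (hc.refine ?_), ?_, ?_⟩
          · intro u hu w hw huw
            rwa [hagree u hu, hagree w hw] at huw
          · intro u hu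
            by_cases hua : u = a
            · subst hua
              rw [Function.update_self]
              split_ifs <;> omega
            · have hu' : u ∈ U.erase a := by grind
              have := hck u hu'
              rw [hagree u hu']
              omega
          · rw [hagree b hbU, Function.update_self]
            split_ifs <;> omega
      · by_cases htree : sizeOn G (U.erase a) + 1 = (U.erase a).card
        · obtain ⟨c, hc, hck, hcb⟩ :=
            RainbowOn.insert_of_const haU hbU hcut (ih2 htree) (by omega)
          rw [hins] at hc hck
          exact ⟨c, hc, fun u hu => by have := hck u hu; omega, hcb⟩
        · obtain ⟨x, hx, y, hy, hxy⟩ := Finset.one_lt_card.1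
            (show 1 < ((U.erase a).filter (G.Adj a)).card by omega)
          obtain ⟨c, hc, hck, hcxy⟩ := ih3 (by omega) x (Finset.mem_of_mem_filter x hx) y
            (Finset.mem_of_mem_filter y hy) hxy
          obtain ⟨c', hc', hck', hfresh⟩ := hc.insert_of_ne haU
            (k := sizeOn G (U.erase a) + 2 - (U.erase a).card)
            (fun u hu => by have := hck u hu; omega) hx hy hcxy
          rw [hins] at hc' hck'
          exact ⟨c', hc', fun u hu => by have := hck' u hu; omega, hfresh b hbU⟩
    · have hne : (U.erase a).Nonempty := by
        rw [← Finset.card_pos]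
        omega
      unfold ConnOn at hcut
      push Not at hcut
      obtain ⟨P, hPU, hPne, hPcl, hPneq⟩ := hcut hne
      have hpart : ∀ P : Finset V, P ⊆ U.erase a → P ≠ U.erase a →
          (∀ p ∈ P, ∀ q ∈ U.erase a, G.Adj p q → q ∈ P) →
          ConnOn G (insert a P) ∧ (insert a P).card < n := by
        intro P h1 h2 h3
        refine ⟨hconn.insert_part ha h1 h3, ?_⟩
        have := Finset.card_lt_card (Finset.ssubset_iff_subset_ne.2 ⟨h1, h2⟩)
        have := Finset.card_insert_le a P
        omega
      obtain ⟨hAc, hAn⟩ := hpart P hPU hPneq hPcl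
      obtain ⟨hBc, hBn⟩ := hpart (U.erase a \ P) Finset.sdiff_subset (by
          obtain ⟨p, hp⟩ := hPne
          intro h
          grind) (by
          intro p hp q hq hpq
          have := hPcl q
          have := hpq.symm
          grind)
      set A := insert a P with hA
      set B := insert a (U.erase a \ P) with hB
      have haA : a ∈ A := Finset.mem_insert_self a _
      have haB : a ∈ B := Finset.mem_insert_self a _
      have hAB : ∀ v ∈ A, v ∈ B → v = a := by grind
      have hcross : ∀ p ∈ A, ∀ q ∈ B, G.Adj p q → p = a ∨ q = a := by grind
      have hUAB : A ∪ B = U := by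
        clear ih side hconn hpart hAc hAn hBc hBn hcardU
        grind
      have hinter : A ∩ B = {a} := by
        clear ih side hconn hpart hAc hAn hBc hBn hcardU
        grind
      have hcard : A.card + B.card = U.card + 1 := by
        rw [← Finset.card_union_add_card_inter, hUAB, hinter, Finset.card_singleton]
      have hsize := sizeOn_union hAB haA haB hcross
      have hglue : ∀ c, RainbowOn G A c → RainbowOn G B c → RainbowOn G U c :=
        fun c h1 h2 => hUAB ▸ RainbowOn.union haA haB hAB hcross h1 h2
      rw [hUAB] at hsize
      clear_value A B
      have hA1 := ih _ hAn A rfl hAc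
      have hB1 := ih _ hBn B rfl hBc
      refine ⟨by omega, fun h => hglue _ (hA1.2.1 (by omega)) (hB1.2.1 (by omega)),
        fun h b hb hab => ?_⟩
      by_cases hbA : b ∈ A
      · exact side a A B haA haB hAB hUAB hglue hcard hsize hAc hBc hAn hBn h b hbA hab
      · exact side a B A haB haA (fun v h1 h2 => hAB v h2 h1) (by rw [Finset.union_comm, hUAB])
          (fun c h1 h2 => hglue c h2 h1) (by omega) (by omega) hBc hAc hBn hAn h b (by grind) hab
  by_cases h2 : 2 ≤ U.card
  · obtain ⟨a, ha⟩ := hconn.1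
    exact ⟨(main a ha h2).1, (main a ha h2).2.1, fun h a ha b hb hab => (main a ha h2).2.2 h b hb hab⟩
  · have hone : ∀ a ∈ U, ∀ b ∈ U, a = b := Finset.card_le_one.1 (by omega)
    exact ⟨by omega, fun _ a ha b hb hab => absurd (hone a ha b hb) hab,
      fun _ a ha b hb hab => absurd (hone a ha b hb) hab⟩

end

theorem SimpleGraph.Connected.connOn_univ {V : Type*} [Fintype V] {G : SimpleGraph V}
    (h : G.Connected) : ConnOn G Finset.univ := by
  have := h.nonempty
  refine ⟨Finset.univ_nonempty, fun P _ ⟨a, ha⟩ hcl => Finset.eq_univ_of_forall fun b => ?_⟩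
  obtain ⟨w⟩ := h.preconnected a b
  induction w with
  | nil => exact ha
  | cons hadj _ ih => exact ih (hcl _ ha _ (Finset.mem_univ _) hadj)

theorem sizeOn_univ {V : Type*} [Fintype V] [DecidableEq V] (G : SimpleGraph V)
    [DecidableRel G.Adj] : sizeOn G Finset.univ = G.edgeSet.ncard := by
  rw [sizeOn, ← Set.ncard_coe_finset]
  congr 1
  ext e
  simp

theorem RainbowOn.isRVDColoring {V : Type*} [Fintype V] {G : SimpleGraph V} {c : V → ℕ}
    (h : RainbowOn G Finset.univ c) : IsRVDColoring G c := by
  intro x y hxy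
  obtain ⟨S, P, -, -, hxS, hyS, hxP, hyP, hcl, h1, h2⟩ :=
    h x (Finset.mem_univ x) y (Finset.mem_univ y) hxy
  have key : ∀ a b : V, ∀ p : (G.deleteEdges {s(x, y)}).Walk a b, a ∈ P → b ∉ P →
      ∃ v ∈ p.support, v ∈ S := by
    intro a b p
    induction p with
    | nil => exact fun h1 h2 => absurd h1 h2
    | @cons a d b hadj p ih =>
      intro ha hb
      rw [SimpleGraph.deleteEdges_adj] at hadj
      rcases hcl a ha d (Finset.mem_univ d) hadj.1 with h | h | ⟨rfl, rfl⟩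
      · obtain ⟨v, hv, hvS⟩ := ih h hb
        exact ⟨v, by simp [hv], hvS⟩
      · exact ⟨d, by simp, h⟩
      · exact absurd rfl hadj.2
  exact ⟨S, by simpa using hxS, by simpa using hyS, fun p => key x y p hxP hyP, h1, h2⟩

theorem ncard_range_le {V : Type*} {c : V → ℕ} {k : ℕ} (hk : ∀ u, c u < k) :
    (Set.range c).ncard ≤ k := by
  calc (Set.range c).ncard ≤ (Finset.range k : Set ℕ).ncard :=
        Set.ncard_le_ncard (by rintro _ ⟨u, rfl⟩; simpa using hk u) (Finset.finite_toSet _)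
    _ = k := by rw [Set.ncard_coe_finset, Finset.card_range]

/-- A connected graph of order `n ≥ 2` and size `m` has a rainbow vertex-disconnection coloring
with at most `m - n + 2` colors. -/
theorem SimpleGraph.Connected.exists_isRVDColoring {V : Type*} [Fintype V] [Nontrivial V]
    {G : SimpleGraph V} (h : G.Connected) : ∃ c : V → ℕ, IsRVDColoring G c ∧
      (Set.range c).ncard + Fintype.card V ≤ G.edgeSet.ncard + 2 := by
  classical
  obtain ⟨h1, h2, h3⟩ := ConnOn.bounds _ Finset.univ rfl h.connOn_univ
  rw [sizeOn_univ, Finset.card_univ] at h1 h2 h3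
  by_cases htree : G.edgeSet.ncard + 1 = Fintype.card V
  · have := ncard_range_le (V := V) (c := fun _ => 0) (k := 1) (by simp)
    exact ⟨_, (h2 htree).isRVDColoring, by omega⟩
  · obtain ⟨a, b, hab⟩ := exists_pair_ne V
    obtain ⟨c, hc, hck, -⟩ :=
      h3 (by omega) a (Finset.mem_univ a) b (Finset.mem_univ b) hab
    have := ncard_range_le (c := c) (k := G.edgeSet.ncard + 2 - Fintype.card V)
      (fun u => by have := hck u (Finset.mem_univ u); omega)
    exact ⟨c, hc.isRVDColoring, by omega⟩

/-- Two adjacent vertices with `k - 1` common neighbors `2, …, k`, one of them joined to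
every other vertex. -/
def bookGraph (n k : ℕ) : SimpleGraph (Fin n) :=
  SimpleGraph.fromRel fun i j => i.val = 0 ∨ (i.val = 1 ∧ 2 ≤ j.val ∧ j.val ≤ k)

theorem bookGraph_adj {n k : ℕ} {i j : Fin n} : (bookGraph n k).Adj i j ↔
    i.val ≠ j.val ∧ (i.val = 0 ∨ (i.val = 1 ∧ 2 ≤ j.val ∧ j.val ≤ k) ∨
      j.val = 0 ∨ (j.val = 1 ∧ 2 ≤ i.val ∧ i.val ≤ k)) := by
  simp only [bookGraph, SimpleGraph.fromRel_adj, ne_eq, Fin.ext_iff, or_assoc]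

theorem bookGraph_connected {n k : ℕ} (hn : 0 < n) : (bookGraph n k).Connected := by
  refine (SimpleGraph.connected_iff_exists_forall_reachable _).2 ⟨⟨0, hn⟩, fun w => ?_⟩
  by_cases hw : w.val = 0
  · have : w = ⟨0, hn⟩ := Fin.ext hw
    rw [this]
  · exact (bookGraph_adj.2 ⟨by simpa using Ne.symm hw, by simp⟩ :
      (bookGraph n k).Adj ⟨0, hn⟩ w).reachable

theorem Fin.card_filter_val_mem_Icc {n a b : ℕ} (hb : b < n) :
    (Finset.univ.filter fun i : Fin n => a ≤ i.val ∧ i.val ≤ b).card = b + 1 - a := by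
  rw [← Finset.card_map Fin.valEmbedding, ← Nat.card_Icc]
  congr 1
  ext i
  simp only [Finset.mem_map, Finset.mem_filter, Finset.mem_univ, true_and,
    Fin.valEmbedding_apply, Finset.mem_Icc]
  exact ⟨fun ⟨a, h1, h2⟩ => by omega, fun ⟨h1, h2⟩ => ⟨⟨i, by omega⟩, ⟨h1, h2⟩, rfl⟩⟩

theorem bookGraph_ncard_edgeSet {n k : ℕ} (hk : 1 ≤ k) (hkn : k ≤ n - 1) :
    (bookGraph n k).edgeSet.ncard = n + k - 2 := by
  classical
  let z : Fin n := ⟨0, by omega⟩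
  let o : Fin n := ⟨1, by omega⟩
  let A : Finset (Fin n) := Finset.univ.filter fun i => 1 ≤ i.val ∧ i.val ≤ n - 1
  let B : Finset (Fin n) := Finset.univ.filter fun i => 2 ≤ i.val ∧ i.val ≤ k
  have hA : A.card = n - 1 := (Fin.card_filter_val_mem_Icc (by omega)).trans (by omega)
  have hB : B.card = k - 1 := (Fin.card_filter_val_mem_Icc (by omega)).trans (by omega)
  have hset : (bookGraph n k).edgeSet =
      ((A.image (fun i => s(z, i)) ∪ B.image (fun i => s(o, i)) : Finset (Sym2 (Fin n))) :
        Set (Sym2 (Fin n))) := by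
    ext e
    induction e with
    | _ i j =>
      simp only [SimpleGraph.mem_edgeSet, bookGraph_adj, Finset.coe_union, Finset.coe_image,
        Set.mem_union, Set.mem_image, Finset.mem_coe, A, B, Finset.mem_filter, Finset.mem_univ,
        true_and, Sym2.eq_iff, z, o, Fin.ext_iff]
      constructor
      · rintro ⟨hne, h | h | h | h⟩
        · exact .inl ⟨j, by omega, .inl ⟨h.symm, rfl⟩⟩
        · exact .inr ⟨j, by omega, .inl ⟨h.1.symm, rfl⟩⟩
        · exact .inl ⟨i, by omega, .inr ⟨h.symm, rfl⟩⟩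
        · exact .inr ⟨i, by omega, .inr ⟨h.1.symm, rfl⟩⟩
      · rintro (⟨a, h1, h2⟩ | ⟨a, h1, h2⟩) <;> omega
  rw [hset, Set.ncard_coe_finset, Finset.card_union_of_disjoint,
    Finset.card_image_of_injective _ fun a b h => Sym2.congr_right.1 h,
    Finset.card_image_of_injective _ fun a b h => Sym2.congr_right.1 h, hA, hB]
  · omega
  · rw [Finset.disjoint_left]
    intro e he he'
    simp only [Finset.mem_image, A, B, Finset.mem_filter, Finset.mem_univ, true_and] at he he'
    obtain ⟨i, hi, rfl⟩ := he
    obtain ⟨j, hj, h⟩ := he'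
    simp only [Sym2.eq_iff, z, o, Fin.ext_iff] at h
    omega

theorem le_ncard_range_of_bookGraph {n k : ℕ} (hk : 1 ≤ k) (hkn : k ≤ n - 1) {c : Fin n → ℕ}
    (hc : IsRVDColoring (bookGraph n k) c) : k ≤ (Set.range c).ncard := by
  let z : Fin n := ⟨0, by omega⟩
  let o : Fin n := ⟨1, by omega⟩
  have hzo : z ≠ o := by simp [z, o]
  have hz : z.val = 0 := rfl
  have ho : o.val = 1 := rfl
  obtain ⟨S, hzS, hoS, hwalk, -, hadj⟩ := hc z o hzo
  let B : Finset (Fin n) := Finset.univ.filter fun i => 2 ≤ i.val ∧ i.val ≤ k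
  have hB : B.card = k - 1 := (Fin.card_filter_val_mem_Icc (by omega)).trans (by omega)
  have hBS : ∀ j ∈ B, j ∈ S := by
    intro j hj
    have hj' : 2 ≤ j.val ∧ j.val ≤ k := by simpa [B] using hj
    have hzj : ((bookGraph n k).deleteEdges {s(z, o)}).Adj z j := by
      simp only [SimpleGraph.deleteEdges_adj, bookGraph_adj, Set.mem_singleton_iff, Sym2.eq_iff,
        Fin.ext_iff]
      omega
    have hjo : ((bookGraph n k).deleteEdges {s(z, o)}).Adj j o := by
      simp only [SimpleGraph.deleteEdges_adj, bookGraph_adj, Set.mem_singleton_iff, Sym2.eq_iff,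
        Fin.ext_iff]
      omega
    obtain ⟨v, hv, hvS⟩ := hwalk (.cons hzj (.cons hjo .nil))
    simp only [SimpleGraph.Walk.support_cons, SimpleGraph.Walk.support_nil, List.mem_cons,
      List.not_mem_nil, or_false] at hv
    rcases hv with rfl | rfl | rfl
    · exact absurd hvS hzS
    · exact hvS
    · exact absurd hvS hoS
  have key : ∀ w, w ∉ B → Set.InjOn c (insert w S) → k ≤ (Set.range c).ncard := by
    intro w hwB hinj
    calc k = (insert w B).card := by
          rw [Finset.card_insert_of_notMem hwB]
          omega
      _ = ((insert w B).image c).card := by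
          refine (Finset.card_image_of_injOn (hinj.mono ?_)).symm
          intro u hu
          rw [Finset.coe_insert] at hu
          exact hu.imp id (hBS u)
      _ ≤ (Set.range c).ncard := by
          rw [← Set.ncard_coe_finset]
          refine Set.ncard_le_ncard ?_ (Set.finite_range c)
          rw [Finset.coe_image]
          exact Set.image_subset_range c _
  have hzo' : (bookGraph n k).Adj z o := bookGraph_adj.2 (by simp [z, o])
  exact (hadj hzo').elim (key z (by simp [B, z])) (key o (by simp [B, o]))

/-- For integers `k, n` with `1 ≤ k ≤ n - 1`, the minimum size of a connected graph
of order `n` with `rvd = k` is `n + k - 2`: every connected graph of order `n` and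
size `n + k - 2` has `rvd ≤ k`; every connected graph of order `n` with `rvd = k`
has at least `n + k - 2` edges; and some connected graph of order `n` with exactly
`n + k - 2` edges has `rvd = k`. -/
theorem stmt16 (n k : ℕ) (hk : 1 ≤ k) (hkn : k ≤ n - 1) :
    (∀ G : SimpleGraph (Fin n), G.Connected → G.edgeSet.ncard = n + k - 2 →
      rvd G ≤ k) ∧
    (∀ G : SimpleGraph (Fin n), G.Connected → rvd G = k →
      n + k - 2 ≤ G.edgeSet.ncard) ∧
    (∃ G : SimpleGraph (Fin n), G.Connected ∧ G.edgeSet.ncard = n + k - 2 ∧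
      rvd G = k) := by
  have : Nontrivial (Fin n) := Fin.nontrivial_iff_two_le.2 (by omega)
  have bound : ∀ G : SimpleGraph (Fin n), G.Connected → rvd G + n ≤ G.edgeSet.ncard + 2 := by
    intro G hG
    obtain ⟨c, hc, hcard⟩ := hG.exists_isRVDColoring
    rw [Fintype.card_fin] at hcard
    have : rvd G ≤ (Set.range c).ncard := Nat.sInf_le ⟨c, hc, rfl⟩
    omega
  refine ⟨fun G hG hm => ?_, fun G hG hr => ?_, bookGraph n k, bookGraph_connected (by omega),
    bookGraph_ncard_edgeSet hk hkn, le_antisymm ?_ ?_⟩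
  · have := bound G hG
    omega
  · have := bound G hG
    omega
  · have := bound _ (bookGraph_connected (n := n) (k := k) (by omega))
    rw [bookGraph_ncard_edgeSet hk hkn] at this
    omega
  · have hne : {m | ∃ c : Fin n → ℕ, IsRVDColoring (bookGraph n k) c ∧
        (Set.range c).ncard = m}.Nonempty := by
      obtain ⟨c, hc, -⟩ :=
        (bookGraph_connected (n := n) (k := k) (by omega)).exists_isRVDColoring
      exact ⟨_, c, hc, rfl⟩
    obtain ⟨c, hc, hck⟩ := Nat.sInf_mem hne
    exact (le_ncard_range_of_bookGraph hk hkn hc).trans hck.le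
end

section
/- Let G be a finite simple graph of order n in which any two distinct vertices have at least two common neighbors. Then the number of edges of G satisfies |E(G)| ≥ 2n − 4 + ⌈n/2⌉. Moreover, for every n ≥ 4 this bound is sharp: there exists a graph of order n in which any two distinct vertices have at least two common neighbors and which has exactly 2n − 4 + ⌈n/2⌉ edges. -/
open SimpleGraph

/-- `u` and `v` have at least two common neighbors in `G`. -/
def TwoCommonNbrs {V : Type*} (G : SimpleGraph V) (u v : V) : Prop :=
  ∃ w₁ w₂ : V, w₁ ≠ w₂ ∧ G.Adj u w₁ ∧ G.Adj v w₁ ∧ G.Adj u w₂ ∧ G.Adj v w₂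

section LowerBound

variable {V : Type*} [Fintype V] (G : SimpleGraph V) [DecidableRel G.Adj]

theorem three_le_degree_of_twoCommonNbrs [Nontrivial V]
    (h : ∀ u v : V, u ≠ v → TwoCommonNbrs G u v) (u : V) : 3 ≤ G.degree u := by
  obtain ⟨v, hv⟩ := exists_ne u
  obtain ⟨w, -, -, huw, -⟩ := h u v hv.symm
  obtain ⟨x, y, hxy, hux, hwx, huy, hwy⟩ := h u w huw.ne
  rw [← G.card_neighborFinset_eq_degree]
  exact Finset.two_lt_card.2 ⟨w, by simpa, x, by simpa, y, by simpa, hwx.ne, hwy.ne, hxy⟩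

variable [DecidableEq V]

theorem TwoCommonNbrs.two_le_card_inter {G : SimpleGraph V} [DecidableRel G.Adj] {u v : V}
    (h : TwoCommonNbrs G u v) : 2 ≤ (G.neighborFinset u ∩ G.neighborFinset v).card := by
  obtain ⟨w₁, w₂, hne, h₁, h₂, h₃, h₄⟩ := h
  exact Finset.one_lt_card.2 ⟨w₁, by simp [h₁, h₂], w₂, by simp [h₃, h₄], hne⟩

theorem sum_degree_neighborFinset (v : V) :
    ∑ a ∈ G.neighborFinset v, G.degree a =
      ∑ w, (G.neighborFinset w ∩ G.neighborFinset v).card := by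
  have h := Finset.sum_card_bipartiteAbove_eq_sum_card_bipartiteBelow
    (s := G.neighborFinset v) (t := Finset.univ) G.Adj
  convert h using 2 with a _ w _
  · rw [← G.card_neighborFinset_eq_degree]
    congr 1
    ext; simp [Finset.bipartiteAbove]
  · congr 1
    ext a; simp [Finset.bipartiteBelow, G.adj_comm w a, and_comm]

theorem degree_add_le_sum_degree_neighborFinset
    (h : ∀ u v : V, u ≠ v → TwoCommonNbrs G u v) (v : V) :
    G.degree v + 2 * (Fintype.card V - 1) ≤ ∑ a ∈ G.neighborFinset v, G.degree a := by
  rw [sum_degree_neighborFinset, ← Finset.add_sum_erase _ _ (Finset.mem_univ v)]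
  refine Nat.add_le_add (by simp) ?_
  have := Finset.card_nsmul_le_sum (Finset.univ.erase v)
    (fun w => (G.neighborFinset w ∩ G.neighborFinset v).card) 2
    fun w hw => (h w v (Finset.ne_of_mem_erase hw)).two_le_card_inter
  simpa [Finset.card_erase_of_mem, mul_comm] using this

theorem five_mul_card_le_two_mul_card_edgeFinset
    (h : ∀ u v : V, u ≠ v → TwoCommonNbrs G u v) :
    5 * Fintype.card V ≤ 2 * G.edgeFinset.card + 8 := by
  rcases subsingleton_or_nontrivial V with hV | hV
  · have := Fintype.card_le_one_iff_subsingleton.2 hV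
    omega
  obtain ⟨v, hv⟩ := G.exists_minimal_degree_vertex
  have h3 := three_le_degree_of_twoCommonNbrs G h v
  have hmin (w : V) : G.degree v ≤ G.degree w := hv ▸ G.minDegree_le_degree w
  have hN := degree_add_le_sum_degree_neighborFinset G h v
  have hC := Finset.card_nsmul_le_sum (G.neighborFinset v)ᶜ (fun w => G.degree w) _
    fun w _ => hmin w
  have hall := Finset.card_nsmul_le_sum Finset.univ (fun w => G.degree w) _ fun w _ => hmin w
  have hsum := Finset.sum_add_sum_compl (G.neighborFinset v) (fun w => G.degree w)
  have hlt := G.degree_lt_card_verts v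
  rw [Finset.card_compl, G.card_neighborFinset_eq_degree, smul_eq_mul] at hC
  rw [Finset.card_univ, smul_eq_mul] at hall
  rw [G.sum_degrees_eq_twice_card_edges] at hall hsum
  rcases le_or_gt 5 (G.degree v) with h5 | h5
  · nlinarith
  · interval_cases G.degree v <;> omega

end LowerBound

/-- Two vertices `0` and `1` adjacent to every vertex, the remaining vertices being paired up
consecutively (with the last vertex joined to its predecessor when `n` is odd). -/
def doubleConeGraph (n : ℕ) : SimpleGraph (Fin n) :=
  SimpleGraph.fromRel fun u v =>
    u.val < 2 ∨ (v.val = u.val + 1 ∧ (v.val % 2 = 1 ∨ v.val + 1 = n))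

theorem doubleConeGraph_adj {n : ℕ} {u v : Fin n} :
    (doubleConeGraph n).Adj u v ↔ u.val ≠ v.val ∧
      ((u.val < 2 ∨ (v.val = u.val + 1 ∧ (v.val % 2 = 1 ∨ v.val + 1 = n))) ∨
        (v.val < 2 ∨ (u.val = v.val + 1 ∧ (u.val % 2 = 1 ∨ u.val + 1 = n)))) := by
  simp [doubleConeGraph, Fin.ext_iff]

theorem TwoCommonNbrs.symm {V : Type*} {G : SimpleGraph V} {u v : V}
    (h : TwoCommonNbrs G u v) : TwoCommonNbrs G v u := by
  obtain ⟨w₁, w₂, hne, h₁, h₂, h₃, h₄⟩ := h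
  exact ⟨w₁, w₂, hne, h₂, h₁, h₄, h₃⟩

theorem twoCommonNbrs_doubleConeGraph {n : ℕ} (hn : 4 ≤ n) (u v : Fin n) (huv : u ≠ v) :
    TwoCommonNbrs (doubleConeGraph n) u v := by
  wlog hlt : u < v generalizing u v
  · exact (this v u huv.symm (lt_of_le_of_ne (not_lt.1 hlt) huv.symm)).symm
  obtain ⟨u, hu⟩ := u
  obtain ⟨v, hv⟩ := v
  simp only [Fin.mk_lt_mk] at hlt
  simp only [TwoCommonNbrs, doubleConeGraph_adj, ne_eq, Fin.ext_iff]
  by_cases hu2 : 2 ≤ u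
  · exact ⟨⟨0, by omega⟩, ⟨1, by omega⟩, by dsimp only; omega⟩
  by_cases hv2 : v < 2
  · exact ⟨⟨2, by omega⟩, ⟨3, by omega⟩, by dsimp only; omega⟩
  by_cases hv' : v % 2 = 1 ∨ v + 1 = n
  · exact ⟨⟨1 - u, by omega⟩, ⟨if v = 2 then 3 else v - 1, by split_ifs <;> omega⟩,
      by dsimp only; split_ifs <;> omega⟩
  · exact ⟨⟨1 - u, by omega⟩, ⟨v + 1, by omega⟩, by dsimp only; omega⟩

theorem ncard_edgeSet_doubleConeGraph_le {n : ℕ} (hn : 4 ≤ n) :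
    (doubleConeGraph n).edgeSet.ncard ≤ 2 * n - 4 + (n + 1) / 2 := by
  let f (i : ℕ) : Fin n := ⟨min i (n - 1), by omega⟩
  let A := (Finset.range (n - 1)).image fun j => s(f 0, f (j + 1))
  let B := (Finset.range (n - 2)).image fun j => s(f 1, f (j + 2))
  let C := (Finset.range ((n - 1) / 2)).image
    fun k => s(f (min (2 * k + 3) (n - 1) - 1), f (2 * k + 3))
  have hA : A.card ≤ n - 1 := Finset.card_image_le.trans (by simp)
  have hB : B.card ≤ n - 2 := Finset.card_image_le.trans (by simp)
  have hC : C.card ≤ (n - 1) / 2 := Finset.card_image_le.trans (by simp)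
  have hsub : (doubleConeGraph n).edgeSet ⊆ ((A ∪ B ∪ C : Finset (Sym2 (Fin n))) : Set _) := by
    intro e
    induction e with | h u v
    intro he
    have hadj := doubleConeGraph_adj.1 ((doubleConeGraph n).mem_edgeSet.1 he)
    obtain ⟨u, hu⟩ := u
    obtain ⟨v, hv⟩ := v
    dsimp only at hadj
    simp only [A, B, C, f, Finset.coe_union, Set.mem_union, Finset.mem_coe, Finset.mem_image,
      Finset.mem_range, Sym2.eq_iff, Fin.mk.injEq]
    by_cases h0 : u = 0 ∨ v = 0
    · exact .inl (.inl ⟨u + v - 1, by omega, by omega⟩)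
    by_cases h1 : u = 1 ∨ v = 1
    · exact .inl (.inr ⟨u + v - 3, by omega, by omega⟩)
    · exact .inr ⟨(max u v - 2) / 2, by omega, by omega⟩
  have := (Set.ncard_le_ncard hsub).trans_eq (Set.ncard_coe_finset _)
  have h₁ := Finset.card_union_le (A ∪ B) C
  have h₂ := Finset.card_union_le A B
  omega

/-- If any two distinct vertices of a graph `G` of order `n` have at least two common
neighbors, then `|E(G)| ≥ 2n - 4 + ⌈n/2⌉`; moreover, for every `n ≥ 4` this bound is
attained by some graph of order `n` with this property. -/
theorem stmt17 :
    (∀ (n : ℕ) (G : SimpleGraph (Fin n)),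
      (∀ u v : Fin n, u ≠ v → TwoCommonNbrs G u v) →
      2 * (n : ℤ) - 4 + ((n : ℤ) + 1) / 2 ≤ (G.edgeSet.ncard : ℤ)) ∧
    (∀ n : ℕ, 4 ≤ n → ∃ G : SimpleGraph (Fin n),
      (∀ u v : Fin n, u ≠ v → TwoCommonNbrs G u v) ∧
      G.edgeSet.ncard = 2 * n - 4 + (n + 1) / 2) := by
  classical
  have lower (n : ℕ) (G : SimpleGraph (Fin n))
      (h : ∀ u v : Fin n, u ≠ v → TwoCommonNbrs G u v) :
      5 * n ≤ 2 * G.edgeSet.ncard + 8 := by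
    have := five_mul_card_le_two_mul_card_edgeFinset G h
    rwa [Fintype.card_fin, ← Set.ncard_coe_finset, coe_edgeFinset] at this
  refine ⟨fun n G h => ?_, fun n hn => ⟨doubleConeGraph n, twoCommonNbrs_doubleConeGraph hn, ?_⟩⟩
  · have := lower n G h
    omega
  · have := lower n _ (twoCommonNbrs_doubleConeGraph hn)
    have := ncard_edgeSet_doubleConeGraph_le hn
    omega
end
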